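/- arXiv:1903.05183 — 3 statements merged into one kernel-verified Lean document; each statement's English description precedes it below -/
import Mathlib

section
/- Let A ∈ M_n(ℂ) and assume that A is not a 2×2 normal matrix. If k(A) = 2, then the boundary of W(A) contains no flat portion: for every φ ∈ ℝ, the set of points z ∈ W(A) at which Re(e^{-iφ}z) attains its maximum over W(A) consists of exactly one point. -/
open Matrix Complex

noncomputable section

/-- The numerical range `W(A) = {⟨Ax, x⟩ : ‖x‖ = 1}` (here `⟨Ax, x⟩ = x* A x`). -/
def numRange {n : ℕ} (A : Matrix (Fin n) (Fin n) ℂ) : Set ℂ :=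
  {z | ∃ x : Fin n → ℂ, star x ⬝ᵥ x = 1 ∧ star x ⬝ᵥ A.mulVec x = z}

/-- The Gau–Wu number `k(A)`: the maximum cardinality of an orthonormal family whose
quadratic-form values all lie on the boundary of `W(A)`. -/
def gauWu {n : ℕ} (A : Matrix (Fin n) (Fin n) ℂ) : ℕ :=
  sSup {k : ℕ | ∃ f : Fin k → (Fin n → ℂ),
    (∀ i j, star (f i) ⬝ᵥ f j = if i = j then (1 : ℂ) else 0) ∧
    ∀ j, star (f j) ⬝ᵥ A.mulVec (f j) ∈ frontier (numRange A)}


lemma gw_frontier {W : Set ℂ} {c z : ℂ} (hc : c ≠ 0) (hz : z ∈ W)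
    (h : ∀ w ∈ W, (c * w).re ≤ (c * z).re) : z ∈ frontier W := by
  refine ⟨subset_closure hz, fun hi => ?_⟩
  rw [mem_interior_iff_mem_nhds] at hi
  have ht : Filter.Tendsto (fun t : ℝ => z + (t : ℂ) * c⁻¹) (nhdsWithin 0 (Set.Ioi 0)) (nhds z) := by
    have : Continuous (fun t : ℝ => z + (t : ℂ) * c⁻¹) := by fun_prop
    have h2 := this.tendsto 0
    simp only [ofReal_zero, zero_mul, add_zero] at h2
    exact h2.mono_left nhdsWithin_le_nhds
  have h3 := (ht.eventually hi).and self_mem_nhdsWithin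
  obtain ⟨t, h4, h5⟩ := h3.exists
  have h6 := h _ h4
  have h7 : c * (z + (t : ℂ) * c⁻¹) = c * z + t := by field_simp
  rw [h7] at h6
  simp only [add_re, ofReal_re] at h6
  have : (0 : ℝ) < t := h5
  linarith

lemma gw_norm {n : ℕ} (x : Fin n → ℂ) : star x ⬝ᵥ x = ((∑ i, ‖x i‖ ^ 2 : ℝ) : ℂ) := by
  simp only [dotProduct, Pi.star_apply, RCLike.star_def]
  push_cast
  exact Finset.sum_congr rfl fun i _ => by rw [Complex.conj_mul']

lemma gw_normalize {n : ℕ} (y : Fin n → ℂ) (hy : y ≠ 0) :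
    ∃ r : ℝ, 0 < r ∧ star ((r : ℂ) • y) ⬝ᵥ ((r : ℂ) • y) = 1 := by
  have hs : 0 < ∑ i, ‖y i‖ ^ 2 := by
    obtain ⟨i, hi⟩ := Function.ne_iff.mp hy
    refine Finset.sum_pos' (fun _ _ => by positivity) ⟨i, Finset.mem_univ _, ?_⟩
    have : 0 < ‖y i‖ := norm_pos_iff.mpr hi
    positivity
  refine ⟨(√(∑ i, ‖y i‖ ^ 2))⁻¹, by positivity, ?_⟩
  rw [star_smul, smul_dotProduct, dotProduct_smul, gw_norm]
  simp only [RCLike.star_def, conj_ofReal, smul_eq_mul]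
  rw [← ofReal_mul, ← ofReal_mul, ← ofReal_one]
  congr 1
  have := Real.mul_self_sqrt hs.le
  have h2 : √(∑ i, ‖y i‖ ^ 2) ≠ 0 := by positivity
  generalize √(∑ i, ‖y i‖ ^ 2) = s at *
  rw [← this]
  field_simp

lemma gw_exists {n : ℕ} (hn : 0 < n) (A : Matrix (Fin n) (Fin n) ℂ) (c : ℂ) :
    ∃ x : Fin n → ℂ, star x ⬝ᵥ x = 1 ∧ ∀ y : Fin n → ℂ, star y ⬝ᵥ y = 1 →
      (c * (star y ⬝ᵥ A.mulVec y)).re ≤ (c * (star x ⬝ᵥ A.mulVec x)).re := by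
  have hcomp : IsCompact {x : Fin n → ℂ | star x ⬝ᵥ x = 1} := by
    refine Metric.isCompact_of_isClosed_isBounded ?_ ?_
    · exact isClosed_eq (by simp only [dotProduct]; fun_prop) continuous_const
    · refine (Metric.isBounded_closedBall (x := (0 : Fin n → ℂ)) (r := 1)).subset ?_
      intro x hx
      rw [mem_closedBall_zero_iff, pi_norm_le_iff_of_nonneg zero_le_one]
      intro i
      have hx' : star x ⬝ᵥ x = 1 := hx
      rw [gw_norm] at hx'
      have h1 : ∑ i, ‖x i‖ ^ 2 = 1 := by exact_mod_cast hx'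
      have h2 := Finset.single_le_sum (f := fun i => ‖x i‖ ^ 2) (fun i _ => by positivity)
        (Finset.mem_univ i)
      simp only [h1] at h2
      nlinarith [norm_nonneg (x i)]
  have hne : {x : Fin n → ℂ | star x ⬝ᵥ x = 1}.Nonempty := by
    refine ⟨Pi.single ⟨0, hn⟩ 1, ?_⟩
    simp
  obtain ⟨x, hx, hm⟩ := hcomp.exists_isMaxOn hne
    (f := fun x => (c * (star x ⬝ᵥ A.mulVec x)).re)
    (by simp only [dotProduct, mulVec]; fun_prop)
  exact ⟨x, hx, fun y hy => hm hy⟩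

/-- twice the real part of `c A`. -/
def gwH {n : ℕ} (A : Matrix (Fin n) (Fin n) ℂ) (c : ℂ) : Matrix (Fin n) (Fin n) ℂ :=
  c • A + (c • A)ᴴ

lemma gwH_herm {n : ℕ} (A : Matrix (Fin n) (Fin n) ℂ) (c : ℂ) : (gwH A c)ᴴ = gwH A c := by
  simp [gwH, add_comm]

lemma gwH_quad {n : ℕ} (A : Matrix (Fin n) (Fin n) ℂ) (c : ℂ) (x : Fin n → ℂ) :
    star x ⬝ᵥ (gwH A c).mulVec x = ((2 * (c * (star x ⬝ᵥ A.mulVec x)).re : ℝ) : ℂ) := by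
  have h1 : star x ⬝ᵥ (c • A)ᴴ.mulVec x = star (star x ⬝ᵥ (c • A).mulVec x) := by
    rw [← star_dotProduct_star, star_star, star_mulVec, ← dotProduct_mulVec, dotProduct_comm,
      dotProduct_comm]
  rw [gwH, add_mulVec, dotProduct_add, h1, smul_mulVec, dotProduct_smul, smul_eq_mul,
    RCLike.star_def, Complex.add_conj]

lemma gwH_neg {n : ℕ} (A : Matrix (Fin n) (Fin n) ℂ) (c : ℂ) : gwH A (-c) = - gwH A c := by
  simp [gwH, add_comm]

open scoped ComplexOrder in
lemma gw_psd {n : ℕ} (A : Matrix (Fin n) (Fin n) ℂ) (c : ℂ) (m : ℝ)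
    (h : ∀ y : Fin n → ℂ, star y ⬝ᵥ y = 1 → (c * (star y ⬝ᵥ A.mulVec y)).re ≤ m) :
    (((2 * m : ℝ) : ℂ) • (1 : Matrix (Fin n) (Fin n) ℂ) - gwH A c).PosSemidef := by
  refine Matrix.PosSemidef.of_dotProduct_mulVec_nonneg ?_ ?_
  · rw [Matrix.IsHermitian, conjTranspose_sub, gwH_herm, conjTranspose_smul]
    simp
  · intro y
    by_cases hy : y = 0
    · simp [hy]
    obtain ⟨r, hr, hu⟩ := gw_normalize y hy
    have h1 := h _ hu
    rw [star_smul, mulVec_smul, smul_dotProduct, dotProduct_smul] at h1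
    rw [star_smul, smul_dotProduct, dotProduct_smul, gw_norm] at hu
    rw [sub_mulVec, dotProduct_sub, gwH_quad, smul_mulVec, one_mulVec, dotProduct_smul, gw_norm]
    simp only [RCLike.star_def, conj_ofReal, smul_eq_mul] at h1 hu ⊢
    have hu' : r * (r * ∑ i, ‖y i‖ ^ 2) = 1 := by exact_mod_cast hu
    have e : c * (↑r * (↑r * (star y ⬝ᵥ A *ᵥ y))) = ((r * r : ℝ) : ℂ) * (c * (star y ⬝ᵥ A *ᵥ y)) := by
      push_cast; ring
    rw [e, re_ofReal_mul] at h1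
    rw [← ofReal_mul, ← ofReal_sub]
    rw [Complex.zero_le_real]
    generalize (c * (star y ⬝ᵥ A *ᵥ y)).re = q at *
    generalize ∑ i, ‖y i‖ ^ 2 = s at *
    have h3 : 0 ≤ (r * r) * (m * s - q) := by
      have : r * r * (m * s - q) = m * (r * (r * s)) - r * r * q := by ring
      rw [this, hu']; linarith
    have := nonneg_of_mul_nonneg_right h3 (by positivity)
    linarith

open scoped ComplexOrder in
lemma gw_eig {n : ℕ} (A : Matrix (Fin n) (Fin n) ℂ) (c : ℂ) (m : ℝ)
    (h : ∀ y : Fin n → ℂ, star y ⬝ᵥ y = 1 → (c * (star y ⬝ᵥ A.mulVec y)).re ≤ m)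
    (x : Fin n → ℂ) (hx : star x ⬝ᵥ x = 1) (hm : (c * (star x ⬝ᵥ A.mulVec x)).re = m) :
    (gwH A c).mulVec x = ((2 * m : ℝ) : ℂ) • x := by
  have h0 := ((gw_psd A c m h).dotProduct_mulVec_zero_iff x).1 (by
    rw [sub_mulVec, dotProduct_sub, gwH_quad, smul_mulVec, one_mulVec, dotProduct_smul, hx, hm]
    simp)
  rw [sub_mulVec, smul_mulVec, one_mulVec, sub_eq_zero] at h0
  exact h0.symm

lemma gw_val {n : ℕ} (A : Matrix (Fin n) (Fin n) ℂ) (c : ℂ) (m : ℝ)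
    (x : Fin n → ℂ) (hx : star x ⬝ᵥ x = 1)
    (he : (gwH A c).mulVec x = ((2 * m : ℝ) : ℂ) • x) :
    (c * (star x ⬝ᵥ A.mulVec x)).re = m := by
  have h := gwH_quad A c x
  rw [he, dotProduct_smul, hx, smul_eq_mul, mul_one] at h
  have := Complex.ofReal_injective h
  linarith

lemma gw_orth {n : ℕ} (A : Matrix (Fin n) (Fin n) ℂ) (c : ℂ) (a b : ℝ) (hab : a ≠ b)
    (x y : Fin n → ℂ)
    (hx : (gwH A c).mulVec x = (a : ℂ) • x) (hy : (gwH A c).mulVec y = (b : ℂ) • y) :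
    star x ⬝ᵥ y = 0 := by
  have h1 : star x ⬝ᵥ (gwH A c).mulVec y = (b : ℂ) * (star x ⬝ᵥ y) := by
    rw [hy, dotProduct_smul, smul_eq_mul]
  have h2 : star x ⬝ᵥ (gwH A c).mulVec y = (a : ℂ) * (star x ⬝ᵥ y) := by
    rw [dotProduct_mulVec]
    have : star x ᵥ* gwH A c = star ((gwH A c).mulVec x) := by
      rw [star_mulVec, gwH_herm]
    rw [this, hx, star_smul, smul_dotProduct]
    simp
  have h3 : ((a : ℂ) - b) * (star x ⬝ᵥ y) = 0 := by rw [sub_mul, ← h1, ← h2, sub_self]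
  rcases mul_eq_zero.1 h3 with h | h
  · exact absurd (by exact_mod_cast sub_eq_zero.1 h) hab
  · exact h

lemma gw_symm {n : ℕ} {x y : Fin n → ℂ} (h : star x ⬝ᵥ y = 0) : star y ⬝ᵥ x = 0 := by
  have : star y ⬝ᵥ x = star (star x ⬝ᵥ y) := by
    rw [← star_dotProduct_star, star_star]
  rw [this, h, star_zero]

lemma gw_no_three {n : ℕ} (A : Matrix (Fin n) (Fin n) ℂ) (hk : gauWu A = 2)
    (f : Fin 3 → (Fin n → ℂ))
    (h1 : ∀ i j, star (f i) ⬝ᵥ f j = if i = j then (1 : ℂ) else 0)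
    (h2 : ∀ j, star (f j) ⬝ᵥ A.mulVec (f j) ∈ frontier (numRange A)) : False := by
  unfold gauWu at hk
  by_cases hb : BddAbove {k : ℕ | ∃ f : Fin k → (Fin n → ℂ),
    (∀ i j, star (f i) ⬝ᵥ f j = if i = j then (1 : ℂ) else 0) ∧
    ∀ j, star (f j) ⬝ᵥ A.mulVec (f j) ∈ frontier (numRange A)}
  · have := le_csSup hb ⟨f, h1, h2⟩
    omega
  · rw [Nat.sSup_of_not_bddAbove hb] at hk
    omega

lemma gw_two_le {n : ℕ} (A : Matrix (Fin n) (Fin n) ℂ) (hk : gauWu A = 2) : 2 ≤ n := by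
  have hmem : 2 ∈ {k : ℕ | ∃ f : Fin k → (Fin n → ℂ),
    (∀ i j, star (f i) ⬝ᵥ f j = if i = j then (1 : ℂ) else 0) ∧
    ∀ j, star (f j) ⬝ᵥ A.mulVec (f j) ∈ frontier (numRange A)} := by
    rw [← hk]
    unfold gauWu at hk ⊢
    refine Nat.sSup_mem ?_ ?_
    · by_contra hne
      rw [Set.not_nonempty_iff_eq_empty] at hne
      rw [hne] at hk
      simp at hk
    · by_contra hb
      rw [Nat.sSup_of_not_bddAbove hb] at hk
      omega
  obtain ⟨f, hf, -⟩ := hmem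
  by_contra hn
  have h00 := hf 0 0
  have h11 := hf 1 1
  have h01 := hf 0 1
  interval_cases n
  · simp [dotProduct] at h00
  · simp [dotProduct] at h00 h11 h01
    rcases h01 with h | h
    · simp [h] at h00
    · simp [h] at h11

theorem no_flat_portion_of_gauWu_eq_two {n : ℕ} (A : Matrix (Fin n) (Fin n) ℂ)
    (hA : ¬ (n = 2 ∧ A * Aᴴ = Aᴴ * A))
    (hk : gauWu A = 2) :
    ∀ φ : ℝ, ∃! z : ℂ, z ∈ numRange A ∧
      ∀ w ∈ numRange A,
        (Complex.exp (-(φ : ℂ) * Complex.I) * w).re ≤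
          (Complex.exp (-(φ : ℂ) * Complex.I) * z).re := by
  intro φ
  have hc : Complex.exp (-(φ : ℂ) * Complex.I) ≠ 0 := Complex.exp_ne_zero _
  generalize Complex.exp (-(φ : ℂ) * Complex.I) = c at hc ⊢
  have hn := gw_two_le A hk
  obtain ⟨x, hx, hmax⟩ := gw_exists (by omega) A c
  obtain ⟨w, hw, hmin⟩ := gw_exists (by omega) A (-c)
  refine ⟨star x ⬝ᵥ A.mulVec x, ⟨⟨x, hx, rfl⟩, ?_⟩, ?_⟩
  · rintro _ ⟨y, hy, rfl⟩
    exact hmax y hy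
  rintro _ ⟨⟨x2, hx2, rfl⟩, hmax2⟩
  by_contra hne
  obtain ⟨m, hm⟩ : ∃ m, m = (c * (star x ⬝ᵥ A.mulVec x)).re := ⟨_, rfl⟩
  rw [← hm] at hmax
  have hm2 : (c * (star x2 ⬝ᵥ A.mulVec x2)).re = m :=
    le_antisymm (hmax x2 hx2) (hm ▸ hmax2 _ ⟨x, hx, rfl⟩)
  obtain ⟨m', hm'⟩ : ∃ m, m = (-c * (star w ⬝ᵥ A.mulVec w)).re := ⟨_, rfl⟩
  rw [← hm'] at hmin
  have hEx := gw_eig A c m hmax x hx hm.symm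
  have hEx2 := gw_eig A c m hmax x2 hx2 hm2
  have hEw := gw_eig A (-c) m' hmin w hw hm'.symm
  have hfr : ∀ y : Fin n → ℂ, star y ⬝ᵥ y = 1 → (c * (star y ⬝ᵥ A.mulVec y)).re = m →
      star y ⬝ᵥ A.mulVec y ∈ frontier (numRange A) := by
    intro y hy hym
    refine gw_frontier hc ⟨y, hy, rfl⟩ ?_
    rintro _ ⟨v, hv, rfl⟩
    rw [hym]; exact hmax v hv
  have hfw : star w ⬝ᵥ A.mulVec w ∈ frontier (numRange A) := by
    refine gw_frontier (neg_ne_zero.2 hc) ⟨w, hw, rfl⟩ ?_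
    rintro _ ⟨v, hv, rfl⟩
    rw [← hm']; exact hmin v hv
  by_cases hmm : m = -m'
  · skip
    have hall : ∀ y : Fin n → ℂ, star y ⬝ᵥ y = 1 → (c * (star y ⬝ᵥ A.mulVec y)).re = m := by
      intro y hy
      have h1 := hmax y hy
      have h2 := hmin y hy
      rw [neg_mul, neg_re] at h2
      linarith
    have hsingle : ∀ i j : Fin n, star (Pi.single i (1 : ℂ) : Fin n → ℂ) ⬝ᵥ Pi.single j 1 =
        if i = j then (1 : ℂ) else 0 := by
      intro i j
      rw [dotProduct_single]
      simp [Pi.single_apply, eq_comm, apply_ite]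
    by_cases h3 : n = 2
    · apply hA
      refine ⟨h3, ?_⟩
      have hH : gwH A c = ((2 * m : ℝ) : ℂ) • 1 := by
        ext i j
        have hj : star (Pi.single j (1 : ℂ) : Fin n → ℂ) ⬝ᵥ Pi.single j 1 = 1 := by
          simp [hsingle]
        have := congrFun (gw_eig A c m hmax (Pi.single j 1) hj (hall _ hj)) i
        rw [mulVec_single_one] at this
        simpa [Pi.single_apply, Matrix.one_apply] using this
      have hcA : c • A = ((2 * m : ℝ) : ℂ) • 1 - (c • A)ᴴ := by
        rw [← hH, gwH]; simp
      have hcom : (c • A) * (c • A)ᴴ = (c • A)ᴴ * (c • A) := by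
        generalize (c • A)ᴴ = B at hcA ⊢
        rw [hcA, sub_mul, mul_sub]
        simp
      rw [conjTranspose_smul, smul_mul_smul_comm, smul_mul_smul_comm, mul_comm (star c)] at hcom
      exact smul_right_injective _ (mul_ne_zero hc (star_ne_zero.2 hc)) hcom
    · have hn3 : 3 ≤ n := by omega
      refine gw_no_three A hk (fun i => Pi.single (Fin.castLE hn3 i) 1) ?_ ?_
      · intro i j
        rw [hsingle]
        simp [Fin.ext_iff]
      · intro j
        have hj := hsingle (Fin.castLE hn3 j) (Fin.castLE hn3 j)
        rw [if_pos rfl] at hj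
        exact hfr _ hj (hall _ hj)
  · skip
    obtain ⟨a, ha⟩ : ∃ a, a = star x ⬝ᵥ x2 := ⟨_, rfl⟩
    have hy0 : x2 - a • x ≠ 0 := by
      intro h0
      have h1 : x2 = a • x := sub_eq_zero.1 h0
      apply hne
      rw [h1, star_smul, smul_dotProduct, dotProduct_smul, hx] at hx2
      rw [h1, star_smul, mulVec_smul, smul_dotProduct, dotProduct_smul]
      simp only [smul_eq_mul, mul_one] at hx2 ⊢
      rw [← mul_assoc, hx2, one_mul]
    obtain ⟨r, hr, hv⟩ := gw_normalize _ hy0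
    obtain ⟨v, hvdef⟩ : ∃ v, v = (r : ℂ) • (x2 - a • x) := ⟨_, rfl⟩
    rw [← hvdef] at hv
    have hxv : star x ⬝ᵥ v = 0 := by
      rw [hvdef, dotProduct_smul, dotProduct_sub, dotProduct_smul, hx, ← ha]
      simp
    have hEv : (gwH A c).mulVec v = ((2 * m : ℝ) : ℂ) • v := by
      rw [hvdef, mulVec_smul, mulVec_sub, mulVec_smul, hEx, hEx2]
      module
    have hEw' : (gwH A c).mulVec w = ((-(2 * m') : ℝ) : ℂ) • w := by
      rw [gwH_neg, neg_mulVec] at hEw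
      rw [ofReal_neg, neg_smul, ← hEw, neg_neg]
    have hab : 2 * m ≠ -(2 * m') := fun h => hmm (by linarith)
    have hxw := gw_orth A c _ _ hab x w hEx hEw'
    have hvw := gw_orth A c _ _ hab v w hEv hEw'
    refine gw_no_three A hk ![x, v, w] ?_ ?_
    · intro i j
      fin_cases i <;> fin_cases j <;>
        simp [hx, hv, hw, hxv, hxw, hvw, gw_symm hxv, gw_symm hxw, gw_symm hvw]
    · intro j
      fin_cases j
      · exact hfr x hx hm.symm
      · exact hfr v hv (gw_val A c m v hv hEv)
      · exact hfw
end
end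

section
/- Let n ≥ 2 and let A ∈ M_n(ℂ) be unitarily irreducible. Then k(A) = n if and only if there exists θ ∈ ℝ such that the Hermitian matrix Re(e^{-iθ}A) has exactly two distinct eigenvalues. -/
open Matrix Complex

noncomputable section

/-- The Hermitian part `Re A = (A + A*)/2` of a complex matrix. -/
def reM {n : ℕ} (A : Matrix (Fin n) (Fin n) ℂ) : Matrix (Fin n) (Fin n) ℂ :=
  (2⁻¹ : ℂ) • (A + Aᴴ)

/-- `A` is unitarily irreducible: no nontrivial proper subspace is invariant under
both `A` and `A*`. -/
def UnitarilyIrreducible {n : ℕ} (A : Matrix (Fin n) (Fin n) ℂ) : Prop :=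
  ¬ ∃ L : Submodule ℂ (Fin n → ℂ), 0 < Module.finrank ℂ L ∧ Module.finrank ℂ L < n ∧
      (∀ x ∈ L, A.mulVec x ∈ L) ∧ (∀ x ∈ L, Aᴴ.mulVec x ∈ L)

section
open scoped ComplexOrder

lemma star_dot_self_pos {n : ℕ} {u : Fin n → ℂ} (hu : u ≠ 0) :
    ∃ r : ℝ, 0 < r ∧ star u ⬝ᵥ u = (r : ℂ) := by
  have h : (0 : ℂ) < star u ⬝ᵥ u := Matrix.dotProduct_star_self_pos_iff.2 hu
  rw [Complex.lt_def] at h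
  refine ⟨(star u ⬝ᵥ u).re, h.1, ?_⟩
  apply Complex.ext
  · simp
  · simpa using h.2.symm

lemma mem_numRange_of {n : ℕ} (A : Matrix (Fin n) (Fin n) ℂ) {u : Fin n → ℂ} (hu : u ≠ 0)
    {z : ℂ} (h : star u ⬝ᵥ A.mulVec u = z * (star u ⬝ᵥ u)) : z ∈ numRange A := by
  obtain ⟨r, hr, hru⟩ := star_dot_self_pos hu
  have hs : ((√r)⁻¹ : ℂ) * ((√r)⁻¹ : ℂ) * r = 1 := by
    have h1 : ((√r : ℝ) : ℂ) * ((√r : ℝ) : ℂ) = r := by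
      rw [← Complex.ofReal_mul, Real.mul_self_sqrt hr.le]
    have h2 : ((√r : ℝ) : ℂ) ≠ 0 := by
      rw [Complex.ofReal_ne_zero]; positivity
    rw [← h1]; field_simp
  refine ⟨((√r)⁻¹ : ℂ) • u, ?_, ?_⟩
  · simp only [star_smul, smul_dotProduct, dotProduct_smul, hru, smul_eq_mul]
    rw [← hs]; simp [mul_assoc]
  · simp only [star_smul, smul_dotProduct, mulVec_smul, dotProduct_smul, h, hru, smul_eq_mul]
    have : star ((√r : ℂ))⁻¹ = ((√r : ℂ))⁻¹ := by simp
    rw [this]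
    linear_combination z * hs

lemma exists_unimodular (p q : ℂ) : ∃ c : ℂ, star c * c = 1 ∧ (star c * p + c * q).im = 0 := by
  have key : ∀ c : ℂ, (star c * p + c * q).im = (c * (q - star p)).im := by
    intro c; simp; ring
  by_cases hw : q - star p = 0
  · exact ⟨1, by simp, by rw [key, hw]; simp⟩
  · have hn : ((‖q - star p‖ : ℝ) : ℂ) ≠ 0 := by
      rw [Complex.ofReal_ne_zero]; exact norm_ne_zero_iff.2 hw
    have hm : star (q - star p) * (q - star p) = (‖q - star p‖ : ℂ) * (‖q - star p‖ : ℂ) := by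
      have := Complex.conj_mul' (q - star p)
      rw [pow_two] at this
      exact this
    refine ⟨star (q - star p) / (‖q - star p‖ : ℂ), ?_, ?_⟩
    · rw [star_div₀, star_star]
      have : star ((‖q - star p‖ : ℝ) : ℂ) = (‖q - star p‖ : ℂ) := Complex.conj_ofReal _
      rw [this, div_mul_div_comm, mul_comm (q - star p), hm]
      field_simp
    · rw [key, div_mul_eq_mul_div, hm, mul_div_assoc, div_self hn, mul_one, Complex.ofReal_im]

/-- Toeplitz–Hausdorff. -/
lemma convex_numRange {n : ℕ} (A : Matrix (Fin n) (Fin n) ℂ) : Convex ℝ (numRange A) := by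
  rw [convex_iff_segment_subset]
  rintro a ⟨x, hx, hxa⟩ b ⟨y, hy, hyb⟩ z hz
  rw [segment_eq_image'] at hz
  obtain ⟨s, ⟨hs0, hs1⟩, rfl⟩ := hz
  by_cases hab : a = b
  · subst hab
    exact ⟨x, hx, by simp [hxa]⟩
  have hd : b - a ≠ 0 := sub_ne_zero.2 (Ne.symm hab)
  set p : ℂ := (star x ⬝ᵥ A.mulVec y - a * (star x ⬝ᵥ y)) / (b - a) with hp
  set q : ℂ := (star y ⬝ᵥ A.mulVec x - a * (star y ⬝ᵥ x)) / (b - a) with hq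
  obtain ⟨c, hc, him⟩ := exists_unimodular p q
  set m : ℝ := (star c * p + c * q).re with hm
  have hmc : star c * p + c * q = (m : ℂ) := by
    apply Complex.ext <;> simp [hm, him] <;> simpa using him
  have hyx : star y ⬝ᵥ x = star (star x ⬝ᵥ y) := by
    rw [star_dotProduct]
  set l : ℝ := 2 * (star c * (star x ⬝ᵥ y)).re with hl
  have hlc : star c * (star x ⬝ᵥ y) + c * (star y ⬝ᵥ x) = (l : ℂ) := by
    rw [hyx]
    apply Complex.ext <;> simp [hl] <;> ring
  -- expansions
  let u : ℝ → (Fin n → ℂ) := fun t => (((1 - t : ℝ) : ℂ) * c) • x + (t : ℂ) • y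
  have hN : ∀ t : ℝ, star (u t) ⬝ᵥ u t = (((1 - t) ^ 2 + t ^ 2 + t * (1 - t) * l : ℝ) : ℂ) := by
    intro t
    have : star (u t) ⬝ᵥ u t = (1 - t : ℂ) ^ 2 * (star c * c) + t ^ 2 + t * (1 - t) *
        (star c * (star x ⬝ᵥ y) + c * (star y ⬝ᵥ x)) := by
      simp only [u, star_add, star_smul, add_dotProduct, dotProduct_add, smul_dotProduct,
        dotProduct_smul, hx, hy, smul_eq_mul, star_mul']
      simp
      ring
    rw [this, hc, hlc]; push_cast; ring
  have hQ : ∀ t : ℝ, star (u t) ⬝ᵥ A.mulVec (u t) = a * (star (u t) ⬝ᵥ u t) +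
      (b - a) * ((t ^ 2 + t * (1 - t) * m : ℝ) : ℂ) := by
    intro t
    have : star (u t) ⬝ᵥ A.mulVec (u t) - a * (star (u t) ⬝ᵥ u t) = 
      (b - a) * (t ^ 2 + t * (1 - t) * (star c * p + c * q)) := by
      have e1 : (b - a) * p = (star x ⬝ᵥ A.mulVec y - a * (star x ⬝ᵥ y)) := by
        rw [hp]; field_simp
      have e2 : (b - a) * q = (star y ⬝ᵥ A.mulVec x - a * (star y ⬝ᵥ x)) := by
        rw [hq]; field_simp
      have : (b - a) * (t ^ 2 + t * (1 - t) * (star c * p + c * q)) = (b - a) * t ^ 2 +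
         t * (1 - t) * (star c * ((b - a) * p) + c * ((b - a) * q)) := by ring
      rw [this, e1, e2]
      simp only [u, star_add, star_smul, add_dotProduct, dotProduct_add, smul_dotProduct,
        dotProduct_smul, hx, hy, smul_eq_mul, star_mul', mulVec_add, mulVec_smul, hxa, hyb]
      simp
      ring
    rw [hmc] at this
    rw [eq_add_of_sub_eq' this]; push_cast; ring
  have hcont : ContinuousOn (fun t : ℝ => t ^ 2 + t * (1 - t) * m -
      s * ((1 - t) ^ 2 + t ^ 2 + t * (1 - t) * l)) (Set.Icc 0 1) := by fun_prop
  have hivt := intermediate_value_Icc (zero_le_one' ℝ) hcont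
  obtain ⟨t, ht, h0⟩ := hivt (show (0 : ℝ) ∈ _ by constructor <;> norm_num <;> linarith)
  have hval : star (u t) ⬝ᵥ A.mulVec (u t) = (a + s • (b - a)) * (star (u t) ⬝ᵥ u t) := by
    have h0' : t ^ 2 + t * (1 - t) * m = s * ((1 - t) ^ 2 + t ^ 2 + t * (1 - t) * l) := by
      simpa [sub_eq_zero] using h0
    rw [hQ, h0', hN, Complex.real_smul]; push_cast; ring
  refine mem_numRange_of A ?_ hval
  intro hu0
  have hcx : (t : ℂ) • y = -((((1 - t : ℝ) : ℂ) * c) • x) := by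
    rw [eq_neg_iff_add_eq_zero, add_comm]; exact hu0
  have h1 : star ((t : ℂ) • y) ⬝ᵥ A.mulVec ((t : ℂ) • y) - a * (star ((t : ℂ) • y) ⬝ᵥ ((t : ℂ) • y)) = 0 := by
    rw [hcx]
    simp only [star_neg, star_smul, neg_dotProduct, mulVec_neg, dotProduct_neg, neg_neg,
      smul_dotProduct, dotProduct_smul, mulVec_smul, hxa, hx, smul_eq_mul]
    ring
  have h2 : (t : ℂ) ^ 2 * (b - a) = 0 := by
    rw [← h1]
    simp only [star_smul, smul_dotProduct, dotProduct_smul, mulVec_smul, hyb, hy, smul_eq_mul]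
    simp
    ring
  have ht0 : t = 0 := by simpa [hd] using h2
  have := hN t
  rw [hu0, ht0] at this
  norm_num at this

lemma exists_angle {n : ℕ} (A : Matrix (Fin n) (Fin n) ℂ) {z : ℂ} (hzW : z ∈ numRange A)
    (hz : z ∈ frontier (numRange A)) :
    ∃ θ : ℝ, ∀ w ∈ numRange A, (Complex.exp (-(θ : ℂ) * Complex.I) * w).re ≤
      (Complex.exp (-(θ : ℂ) * Complex.I) * z).re := by
  have hni : z ∉ interior (numRange A) := hz.2
  have hf : ∃ f : ℂ →ₗ[ℝ] ℝ, f ≠ 0 ∧ ∀ w ∈ numRange A, f w ≤ f z := by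
    by_cases hi : (interior (numRange A)).Nonempty
    · obtain ⟨f, hf, h⟩ := geometric_hahn_banach_of_nonempty_interior_point
        (convex_numRange A) hni hi
      refine ⟨f.toLinearMap, ?_, h⟩
      intro h0
      apply hf
      ext w
      all_goals simpa using LinearMap.congr_fun h0 _
    · rw [(convex_numRange A).interior_nonempty_iff_affineSpan_eq_top] at hi
      have hz' := subset_affineSpan ℝ _ hzW
      have hlt : (affineSpan ℝ (numRange A)).direction < ⊤ := by
        rw [lt_top_iff_ne_top]
        intro h
        exact hi ((AffineSubspace.direction_eq_top_iff_of_nonempty ⟨z, hz'⟩).1 h)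
      obtain ⟨f, hf, hle⟩ := Submodule.exists_le_ker_of_lt_top _ hlt
      refine ⟨f, hf, fun w hw => ?_⟩
      have := hle (AffineSubspace.vsub_mem_direction (subset_affineSpan ℝ _ hw) hz')
      simp [sub_eq_zero] at this
      exact this.le
  obtain ⟨f, hf0, hf⟩ := hf
  let c : ℂ := ⟨f 1, f Complex.I⟩
  have hfc : ∀ w, f w = (star c * w).re := by
    intro w
    have : w = w.re • (1 : ℂ) + w.im • Complex.I := by
      apply Complex.ext <;> simp
    conv_lhs => rw [this, map_add, map_smul, map_smul]
    simp [c]; ring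
  have hc : c ≠ 0 := by
    rintro h
    apply hf0
    ext w
    all_goals simp [hfc, h]
  have hcs : star c = (‖c‖ : ℂ) * Complex.exp (-(c.arg : ℂ) * Complex.I) := by
    conv_lhs => rw [← Complex.norm_mul_exp_arg_mul_I c]
    rw [star_mul']
    congr 1
    · exact Complex.conj_ofReal _
    · have := Complex.exp_conj (c.arg * Complex.I)
      simp at this
      simpa using this.symm
  refine ⟨c.arg, fun w hw => ?_⟩
  have := hf w hw
  rw [hfc, hfc, hcs, mul_assoc, mul_assoc, Complex.re_ofReal_mul, Complex.re_ofReal_mul] at this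
  exact le_of_mul_le_mul_left this (norm_pos_iff.2 hc)

lemma mem_frontier_of_max {n : ℕ} (A : Matrix (Fin n) (Fin n) ℂ) {z c : ℂ} (hc : c ≠ 0)
    (hzW : z ∈ numRange A) (h : ∀ w ∈ numRange A, (c * w).re ≤ (c * z).re) :
    z ∈ frontier (numRange A) := by
  refine ⟨subset_closure hzW, fun hi => ?_⟩
  have hcont : Filter.Tendsto (fun t : ℝ => z + t * c⁻¹) (nhds 0) (nhds z) := by
    have : Continuous (fun t : ℝ => z + t * c⁻¹) := by fun_prop
    simpa using this.tendsto 0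
  have hev := hcont.eventually (isOpen_interior.mem_nhds hi)
  rw [Metric.eventually_nhds_iff] at hev
  obtain ⟨ε, hε, hev⟩ := hev
  have h1 := hev (y := ε / 2) (by simp [abs_of_pos hε]; linarith)
  have h2 := h _ (interior_subset h1)
  rw [mul_add, mul_left_comm, mul_inv_cancel₀ hc] at h2
  simp at h2
  linarith

lemma star_dot_conjTranspose {n : ℕ} (B : Matrix (Fin n) (Fin n) ℂ) (x y : Fin n → ℂ) :
    star x ⬝ᵥ Bᴴ.mulVec y = star (B.mulVec x) ⬝ᵥ y := by
  rw [star_mulVec, dotProduct_mulVec]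

lemma reM_isHermitian {n : ℕ} (B : Matrix (Fin n) (Fin n) ℂ) : (reM B).IsHermitian := by
  unfold reM Matrix.IsHermitian
  rw [conjTranspose_smul, conjTranspose_add, conjTranspose_conjTranspose, add_comm]
  simp

lemma herm_move {n : ℕ} {H : Matrix (Fin n) (Fin n) ℂ} (hH : H.IsHermitian) (x y : Fin n → ℂ) :
    star x ⬝ᵥ H.mulVec y = star (H.mulVec x) ⬝ᵥ y := by
  conv_lhs => rw [← hH.eq]
  exact star_dot_conjTranspose H x y

lemma reM_form {n : ℕ} (B : Matrix (Fin n) (Fin n) ℂ) (x : Fin n → ℂ) :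
    star x ⬝ᵥ (reM B).mulVec x = ((star x ⬝ᵥ B.mulVec x).re : ℂ) := by
  have h1 : star x ⬝ᵥ Bᴴ.mulVec x = star (star x ⬝ᵥ B.mulVec x) := by
    rw [star_dot_conjTranspose, star_dotProduct]
  unfold reM
  rw [smul_mulVec, add_mulVec, dotProduct_smul, dotProduct_add, h1]
  apply Complex.ext <;> simp
  ring

lemma eig_of_max {n : ℕ} (B : Matrix (Fin n) (Fin n) ℂ) (x : Fin n → ℂ)
    (hx : star x ⬝ᵥ x = 1)
    (h : ∀ w ∈ numRange B, w.re ≤ (star x ⬝ᵥ B.mulVec x).re) :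
    (reM B).mulVec x = ((star x ⬝ᵥ B.mulVec x).re : ℂ) • x := by
  set l : ℝ := (star x ⬝ᵥ B.mulVec x).re with hl
  have hform : ∀ y : Fin n → ℂ, star y ⬝ᵥ ((l : ℂ) • (1 : Matrix (Fin n) (Fin n) ℂ) - reM B).mulVec y =
      l * (star y ⬝ᵥ y) - ((star y ⬝ᵥ B.mulVec y).re : ℂ) := by
    intro y
    rw [sub_mulVec, smul_mulVec, one_mulVec, dotProduct_sub, dotProduct_smul, reM_form, smul_eq_mul]
  have hpsd : ((l : ℂ) • (1 : Matrix (Fin n) (Fin n) ℂ) - reM B).PosSemidef := by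
    apply Matrix.PosSemidef.of_dotProduct_mulVec_nonneg
    · apply Matrix.IsHermitian.sub _ (reM_isHermitian B)
      unfold Matrix.IsHermitian
      rw [conjTranspose_smul]
      simp
    · intro y
      rw [hform]
      by_cases hy : y = 0
      · simp [hy]
      obtain ⟨r, hr, hry⟩ := star_dot_self_pos hy
      have hrc : (r : ℂ) ≠ 0 := by exact_mod_cast hr.ne'
      have hm := h _ (mem_numRange_of B hy (z := (star y ⬝ᵥ B.mulVec y) / r)
        (by rw [hry]; field_simp))
      rw [Complex.div_ofReal_re, div_le_iff₀ hr] at hm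
      rw [hry, ← Complex.ofReal_mul, ← Complex.ofReal_sub]
      exact_mod_cast sub_nonneg.2 hm
  have h0 := (hpsd.dotProduct_mulVec_zero_iff x).1 (by rw [hform, hx]; simp [hl])
  rw [sub_mulVec, smul_mulVec, one_mulVec, sub_eq_zero] at h0
  exact h0.symm

lemma onb_expand {n : ℕ} {f : Fin n → (Fin n → ℂ)}
    (hf : ∀ i j, star (f i) ⬝ᵥ f j = if i = j then (1 : ℂ) else 0) (x : Fin n → ℂ) :
    x = ∑ k, (star (f k) ⬝ᵥ x) • f k := by
  let U : Matrix (Fin n) (Fin n) ℂ := Matrix.of fun i j => f j i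
  have h1 : Uᴴ * U = 1 := by
    ext i j
    rw [Matrix.one_apply, ← hf i j]
    rfl
  have h2 : U * Uᴴ = 1 := mul_eq_one_comm.1 h1
  have h3 : U.mulVec (Uᴴ.mulVec x) = x := by rw [mulVec_mulVec, h2, one_mulVec]
  conv_lhs => rw [← h3]
  ext i
  rw [Finset.sum_apply]
  simp only [Matrix.mulVec, dotProduct, Pi.smul_apply, smul_eq_mul]
  apply Finset.sum_congr rfl
  intro k _
  rw [mul_comm]
  rfl

lemma onb_form {n : ℕ} {f : Fin n → (Fin n → ℂ)}
    (hf : ∀ i j, star (f i) ⬝ᵥ f j = if i = j then (1 : ℂ) else 0)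
    {H : Matrix (Fin n) (Fin n) ℂ} {ν : Fin n → ℝ} (hH : ∀ k, H.mulVec (f k) = (ν k : ℂ) • f k)
    (y : Fin n → ℂ) :
    star y ⬝ᵥ H.mulVec y = ((∑ k, ν k * ‖star (f k) ⬝ᵥ y‖ ^ 2 : ℝ) : ℂ) := by
  have h1 : H.mulVec y = ∑ k, (star (f k) ⬝ᵥ y) • (ν k : ℂ) • f k := by
    conv_lhs => rw [onb_expand hf y, mulVec_sum]
    simp only [mulVec_smul, hH]
  rw [h1, dotProduct_sum, Complex.ofReal_sum]
  apply Finset.sum_congr rfl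
  intro k _
  have h2 : star y ⬝ᵥ f k = star (star (f k) ⬝ᵥ y) := by
    rw [star_dotProduct]
  rw [dotProduct_smul, dotProduct_smul, h2, smul_eq_mul, smul_eq_mul]
  have := Complex.mul_conj' (star (f k) ⬝ᵥ y)
  push_cast
  rw [← this, starRingEnd_apply]
  ring

lemma card_le_of_orth {n k : ℕ} {f : Fin k → (Fin n → ℂ)}
    (hf : ∀ i j, star (f i) ⬝ᵥ f j = if i = j then (1 : ℂ) else 0) : k ≤ n := by
  have hli : LinearIndependent ℂ f := by
    rw [Fintype.linearIndependent_iff]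
    intro g hg i
    have : star (f i) ⬝ᵥ ∑ j, g j • f j = g i := by
      simp [dotProduct_sum, dotProduct_smul, hf]
    rw [← this, hg, dotProduct_zero]
  simpa using hli.fintype_card_le_finrank

lemma gauWu_eq_iff {n : ℕ} (hn : 2 ≤ n) (A : Matrix (Fin n) (Fin n) ℂ) :
    gauWu A = n ↔ ∃ f : Fin n → (Fin n → ℂ),
    (∀ i j, star (f i) ⬝ᵥ f j = if i = j then (1 : ℂ) else 0) ∧
    ∀ j, star (f j) ⬝ᵥ A.mulVec (f j) ∈ frontier (numRange A) := by
  unfold gauWu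
  set S : Set ℕ := {k : ℕ | ∃ f : Fin k → (Fin n → ℂ),
    (∀ i j, star (f i) ⬝ᵥ f j = if i = j then (1 : ℂ) else 0) ∧
    ∀ j, star (f j) ⬝ᵥ A.mulVec (f j) ∈ frontier (numRange A)} with hS
  have hb : ∀ k ∈ S, k ≤ n := fun k ⟨f, hf, _⟩ => card_le_of_orth hf
  have hne : S.Nonempty := ⟨0, fun i => i.elim0, fun i => i.elim0, fun i => i.elim0⟩
  constructor
  · intro h
    have := Nat.sSup_mem hne ⟨n, hb⟩
    rw [h] at this
    exact this
  · intro h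
    exact le_antisymm (csSup_le hne hb) (le_csSup ⟨n, hb⟩ h)

lemma hasEig_iff {n : ℕ} (H : Matrix (Fin n) (Fin n) ℂ) (μ : ℂ) :
    Module.End.HasEigenvalue (Matrix.toLin' H) μ ↔ ∃ v, v ≠ 0 ∧ H.mulVec v = μ • v := by
  constructor
  · intro h
    obtain ⟨v, hv⟩ := h.exists_hasEigenvector
    exact ⟨v, hv.2, by simpa using hv.apply_eq_smul⟩
  · rintro ⟨v, hv, h⟩
    exact Module.End.hasEigenvalue_of_hasEigenvector (x := v)
      ⟨Module.End.mem_eigenspace_iff.2 (by simpa using h), hv⟩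

lemma reM_smul_mulVec {n : ℕ} (A : Matrix (Fin n) (Fin n) ℂ) (e : ℂ) (x : Fin n → ℂ) :
    (reM (e • A)).mulVec x = (2⁻¹ : ℂ) • (e • A.mulVec x + star e • Aᴴ.mulVec x) := by
  unfold reM
  rw [conjTranspose_smul, smul_mulVec, add_mulVec, smul_mulVec, smul_mulVec]

lemma not_scalar {n : ℕ} (hn : 2 ≤ n) {A : Matrix (Fin n) (Fin n) ℂ}
    (hirr : UnitarilyIrreducible A) {e : ℂ} (he : star e ≠ 0) (ν : ℂ)
    (h : ∀ x, (reM (e • A)).mulVec x = ν • x) : False := by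
  haveI : NeZero n := ⟨by omega⟩
  obtain ⟨μ, hμ⟩ := Module.End.exists_eigenvalue (Matrix.toLin' A)
  obtain ⟨v, hv0, hv⟩ := (hasEig_iff A μ).1 hμ
  have h2 : Aᴴ.mulVec v = ((star e)⁻¹ * (2 * ν - e * μ)) • v := by
    have := h v
    rw [reM_smul_mulVec, hv] at this
    have h3 : star e • Aᴴ.mulVec v = (2 * ν - e * μ) • v := by
      ext i
      have := congrFun this i
      simp only [Pi.smul_apply, Pi.add_apply, smul_eq_mul] at this ⊢
      linear_combination 2 * this
    rw [mul_smul, ← h3, inv_smul_smul₀ he]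
  apply hirr
  refine ⟨Submodule.span ℂ {v}, ?_, ?_, ?_, ?_⟩
  · rw [finrank_span_singleton hv0]; exact one_pos
  · rw [finrank_span_singleton hv0]; omega
  · intro x hx
    obtain ⟨a, rfl⟩ := Submodule.mem_span_singleton.1 hx
    rw [mulVec_smul, hv]
    exact Submodule.smul_mem _ _ (Submodule.smul_mem _ _ (Submodule.mem_span_singleton_self v))
  · intro x hx
    obtain ⟨a, rfl⟩ := Submodule.mem_span_singleton.1 hx
    rw [mulVec_smul, h2]
    exact Submodule.smul_mem _ _ (Submodule.smul_mem _ _ (Submodule.mem_span_singleton_self v))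

lemma unimod (θ : ℝ) : star (Complex.exp (-(θ : ℂ) * Complex.I)) *
    Complex.exp (-(θ : ℂ) * Complex.I) = 1 := by
  have := Complex.conj_mul' (Complex.exp (-(θ : ℂ) * Complex.I))
  have h2 : ‖Complex.exp (-(θ : ℂ) * Complex.I)‖ = 1 := by
    rw [← Complex.ofReal_neg]; exact Complex.norm_exp_ofReal_mul_I _
  rw [h2] at this
  simpa using this

lemma cross {p q e e' : ℂ} (he : star e * e = 1) (he' : star e' * e' = 1)
    (h : e ^ 2 ≠ e' ^ 2) (h1 : e * p + star e * q = 0) (h2 : e' * p + star e' * q = 0) :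
    p = 0 ∧ q = 0 := by
  have h3 : e ^ 2 * p + q = 0 := by linear_combination e * h1 - q * he
  have h4 : e' ^ 2 * p + q = 0 := by linear_combination e' * h2 - q * he'
  have h5 : (e ^ 2 - e' ^ 2) * p = 0 := by linear_combination h3 - h4
  have hp : p = 0 := (mul_eq_zero.1 h5).resolve_left (sub_ne_zero.2 h)
  refine ⟨hp, ?_⟩
  rw [hp] at h3
  simpa using h3

lemma forward_dir {n : ℕ} (hn : 2 ≤ n)
    (A : Matrix (Fin n) (Fin n) ℂ) (hirr : UnitarilyIrreducible A) (f : Fin n → (Fin n → ℂ))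
    (hf : ∀ i j, star (f i) ⬝ᵥ f j = if i = j then (1 : ℂ) else 0)
    (hfr : ∀ j, star (f j) ⬝ᵥ A.mulVec (f j) ∈ frontier (numRange A)) :
    ∃ θ : ℝ, ∃ α β : ℂ, α ≠ β ∧
      (∃ v, v ≠ 0 ∧ (reM (Complex.exp (-(θ : ℂ) * Complex.I) • A)).mulVec v = α • v) ∧
      (∃ v, v ≠ 0 ∧ (reM (Complex.exp (-(θ : ℂ) * Complex.I) • A)).mulVec v = β • v) ∧
      ∀ μ : ℂ, (∃ v, v ≠ 0 ∧ (reM (Complex.exp (-(θ : ℂ) * Complex.I) • A)).mulVec v = μ • v) →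
        μ = α ∨ μ = β := by
  have hf1 : ∀ j, star (f j) ⬝ᵥ f j = 1 := fun j => by simp [hf]
  have hf0 : ∀ j, f j ≠ 0 := fun j h => by simpa [h] using hf1 j
  have hmem : ∀ j, star (f j) ⬝ᵥ A.mulVec (f j) ∈ numRange A := fun j => ⟨f j, hf1 j, rfl⟩
  choose θ hθ using fun j => exists_angle A (hmem j) (hfr j)
  set e : Fin n → ℂ := fun j => Complex.exp (-(θ j : ℂ) * Complex.I) with he
  have heu : ∀ j, star (e j) * e j = 1 := fun j => unimod (θ j)
  have heig : ∀ j, (reM (e j • A)).mulVec (f j) =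
      ((e j * (star (f j) ⬝ᵥ A.mulVec (f j))).re : ℂ) • f j := by
    intro j
    have := eig_of_max (e j • A) (f j) (hf1 j) (by
      rintro w ⟨y, hy, rfl⟩
      rw [smul_mulVec, smul_mulVec, dotProduct_smul, dotProduct_smul]
      exact hθ j _ ⟨y, hy, rfl⟩)
    rw [this, smul_mulVec, dotProduct_smul, smul_eq_mul]
  have hcross : ∀ j k, e j ^ 2 ≠ e k ^ 2 → star (f k) ⬝ᵥ A.mulVec (f j) = 0 ∧
      star (f k) ⬝ᵥ Aᴴ.mulVec (f j) = 0 := by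
    intro j k hjk
    have hne : k ≠ j := by rintro rfl; exact hjk rfl
    apply cross (heu j) (heu k) hjk
    · have h1 : star (f k) ⬝ᵥ (reM (e j • A)).mulVec (f j) = 0 := by
        rw [heig, dotProduct_smul, hf, if_neg hne, smul_zero]
      rw [reM_smul_mulVec, dotProduct_smul, dotProduct_add, dotProduct_smul, dotProduct_smul] at h1
      simpa using h1
    · have h1 : star (f k) ⬝ᵥ (reM (e k • A)).mulVec (f j) = 0 := by
        rw [herm_move (reM_isHermitian _), heig, star_smul, smul_dotProduct, hf, if_neg hne,
          smul_zero]
      rw [reM_smul_mulVec, dotProduct_smul, dotProduct_add, dotProduct_smul, dotProduct_smul] at h1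
      simpa using h1
  let i0 : Fin n := ⟨0, by omega⟩
  have hall : ∀ k, e k ^ 2 = e i0 ^ 2 := by
    by_contra hcon
    push Not at hcon
    obtain ⟨k0, hk0⟩ := hcon
    let L : Submodule ℂ (Fin n → ℂ) :=
      { carrier := {x | ∀ k, e k ^ 2 ≠ e i0 ^ 2 → star (f k) ⬝ᵥ x = 0}
        add_mem' := by
          intro a b ha hb k hk
          rw [dotProduct_add, ha k hk, hb k hk, add_zero]
        zero_mem' := by intro k hk; simp
        smul_mem' := by
          intro c x hx k hk
          rw [dotProduct_smul, hx k hk, smul_zero] }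
    have hinv : ∀ B : Matrix (Fin n) (Fin n) ℂ,
        (∀ j k, e j ^ 2 ≠ e k ^ 2 → star (f k) ⬝ᵥ B.mulVec (f j) = 0) →
        ∀ x ∈ L, B.mulVec x ∈ L := by
      intro B hB x hx k hk
      rw [onb_expand hf x, mulVec_sum, dotProduct_sum]
      apply Finset.sum_eq_zero
      intro j _
      rw [mulVec_smul, dotProduct_smul, smul_eq_mul]
      by_cases hj : e j ^ 2 = e i0 ^ 2
      · rw [hB j k (by rw [hj]; exact hk.symm), mul_zero]
      · rw [hx j hj, zero_mul]
    apply hirr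
    refine ⟨L, ?_, ?_, hinv A (fun j k h => (hcross j k h).1),
      hinv Aᴴ (fun j k h => (hcross j k h).2)⟩
    · have hin : f i0 ∈ L := by
        intro k hk
        rw [hf, if_neg]
        rintro rfl
        exact hk rfl
      haveI : Nontrivial L := ⟨⟨f i0, hin⟩, 0, fun h => hf0 i0 (congrArg Subtype.val h)⟩
      exact Module.finrank_pos
    · have hlt : L < ⊤ := by
        rw [lt_top_iff_ne_top]
        intro h
        have : f k0 ∈ L := h ▸ Submodule.mem_top
        have := this k0 hk0
        rw [hf1] at this
        exact one_ne_zero this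
      have := Submodule.finrank_lt hlt.ne
      simpa using this
  set ν : Fin n → ℝ := fun k => (e i0 * (star (f k) ⬝ᵥ A.mulVec (f k))).re with hν
  have hpm : ∀ k, (reM (e i0 • A)).mulVec (f k) = (ν k : ℂ) • f k ∧
      ((∀ j, ν j ≤ ν k) ∨ (∀ j, ν k ≤ ν j)) := by
    intro k
    rcases sq_eq_sq_iff_eq_or_eq_neg.1 (hall k) with h | h
    · refine ⟨?_, Or.inl fun j => ?_⟩
      · have := heig k
        rw [h] at this
        exact this
      · have := hθ k _ (hmem j)
        change (e k * _).re ≤ (e k * _).re at this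
        rw [h] at this
        exact this
    · refine ⟨?_, Or.inr fun j => ?_⟩
      · have := heig k
        rw [reM_smul_mulVec] at this ⊢
        rw [h] at this
        ext i
        have := congrFun this i
        simp only [Pi.smul_apply, Pi.add_apply, smul_eq_mul, star_neg, neg_mul, Complex.neg_re,
          Complex.ofReal_neg] at this ⊢
        simp only [hν]
        linear_combination -this
      · have := hθ k _ (hmem j)
        change (e k * _).re ≤ (e k * _).re at this
        rw [h, neg_mul, neg_mul, Complex.neg_re, Complex.neg_re, neg_le_neg_iff] at this
        exact this
  have hex : ∃ k, ν k ≠ ν i0 := by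
    by_contra hcon
    push Not at hcon
    refine not_scalar hn hirr (e := e i0) ?_ (ν i0) ?_
    · intro h
      have := heu i0
      rw [h] at this
      simp at this
    · intro x
      conv_lhs => rw [onb_expand hf x, mulVec_sum]
      conv_rhs => rw [onb_expand hf x, Finset.smul_sum]
      apply Finset.sum_congr rfl
      intro k _
      rw [mulVec_smul, (hpm k).1, hcon k, smul_comm]
  obtain ⟨k1, hk1⟩ := hex
  refine ⟨θ i0, ν i0, ν k1, ?_, ⟨f i0, hf0 i0, (hpm i0).1⟩, ⟨f k1, hf0 k1, (hpm k1).1⟩, ?_⟩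
  · intro h
    exact hk1 (Complex.ofReal_injective h).symm
  · rintro μ ⟨v, hv0, hv⟩
    have : ∃ j, star (f j) ⬝ᵥ v ≠ 0 := by
      by_contra hcon
      push Not at hcon
      apply hv0
      rw [onb_expand hf v]
      simp [hcon]
    obtain ⟨j, hj⟩ := this
    have h1 : star (f j) ⬝ᵥ (reM (e i0 • A)).mulVec v = ν j * (star (f j) ⬝ᵥ v) := by
      rw [herm_move (reM_isHermitian _), (hpm j).1, star_smul, smul_dotProduct, smul_eq_mul]
      congr 1
      exact Complex.conj_ofReal _
    have hμ : μ = ν j := by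
      change (reM (e i0 • A)).mulVec v = μ • v at hv
      rw [hv, dotProduct_smul, smul_eq_mul] at h1
      exact mul_right_cancel₀ hj h1
    have hor : ν j = ν i0 ∨ ν j = ν k1 := by
      by_contra hcon
      push Not at hcon
      obtain ⟨c1, c2⟩ := hcon
      rcases (hpm j).2 with a | a <;> rcases (hpm i0).2 with b | b <;> rcases (hpm k1).2 with c | c
      all_goals
        first
        | exact c1 (le_antisymm (b j) (a i0))
        | exact c1 (le_antisymm (a i0) (b j))
        | exact c2 (le_antisymm (c j) (a k1))
        | exact c2 (le_antisymm (a k1) (c j))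
        | exact hk1 (le_antisymm (b k1) (c i0))
        | exact hk1 (le_antisymm (c i0) (b k1))
    rw [hμ]
    exact hor.imp (congrArg _) (congrArg _)

lemma backward_dir {n : ℕ}
    (A : Matrix (Fin n) (Fin n) ℂ) (e : ℂ) (he : e ≠ 0) (α β : ℂ)
    (h : ∀ μ : ℂ, (∃ v, v ≠ 0 ∧ (reM (e • A)).mulVec v = μ • v) → μ = α ∨ μ = β) :
    ∃ f : Fin n → (Fin n → ℂ),
    (∀ i j, star (f i) ⬝ᵥ f j = if i = j then (1 : ℂ) else 0) ∧
    ∀ j, star (f j) ⬝ᵥ A.mulVec (f j) ∈ frontier (numRange A) := by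
  have hH := reM_isHermitian (e • A)
  set H := reM (e • A) with hHdef
  let f : Fin n → (Fin n → ℂ) := fun j => (hH.eigenvectorBasis j).ofLp
  have hf : ∀ i j, star (f i) ⬝ᵥ f j = if i = j then (1 : ℂ) else 0 := by
    intro i j
    have := (orthonormal_iff_ite.1 hH.eigenvectorBasis.orthonormal) i j
    rw [← this, EuclideanSpace.inner_eq_star_dotProduct, dotProduct_comm]
  have hf1 : ∀ j, star (f j) ⬝ᵥ f j = 1 := fun j => by simp [hf]
  have hf0 : ∀ j, f j ≠ 0 := fun j h => by simpa [h] using hf1 j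
  set ν := hH.eigenvalues with hν
  have hHf : ∀ k, H.mulVec (f k) = (ν k : ℂ) • f k := by
    intro k
    exact hH.mulVec_eigenvectorBasis k
  refine ⟨f, hf, fun i => ?_⟩
  have hαβ : ∀ j, (ν j : ℂ) = α ∨ (ν j : ℂ) = β := fun j => h _ ⟨f j, hf0 j, hHf j⟩
  have hform : ∀ y : Fin n → ℂ, (e * (star y ⬝ᵥ A.mulVec y)).re =
      ∑ k, ν k * ‖star (f k) ⬝ᵥ y‖ ^ 2 := by
    intro y
    have h1 := onb_form hf hHf y
    rw [hHdef, reM_form, smul_mulVec, dotProduct_smul, smul_eq_mul] at h1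
    exact Complex.ofReal_injective h1
  have hone : ∀ y : Fin n → ℂ, star y ⬝ᵥ y = 1 → ∑ k, ‖star (f k) ⬝ᵥ y‖ ^ 2 = 1 := by
    intro y hy
    have h1 := onb_form hf (H := 1) (ν := fun _ => 1) (by simp) y
    rw [one_mulVec, hy] at h1
    simp only [one_mul] at h1
    exact_mod_cast h1.symm
  have hval : (e * (star (f i) ⬝ᵥ A.mulVec (f i))).re = ν i := by
    rw [hform, Finset.sum_eq_single i]
    · rw [hf1]; simp
    · intro k _ hk
      rw [hf, if_neg hk]; simp
    · simp
  have hmm : (∀ j, ν j ≤ ν i) ∨ (∀ j, ν i ≤ ν j) := by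
    by_contra hcon
    push Not at hcon
    obtain ⟨⟨j, hj⟩, k, hk⟩ := hcon
    have n1 : (ν i : ℂ) ≠ ν j := fun hc => hj.ne (Complex.ofReal_injective hc)
    have n2 : (ν k : ℂ) ≠ ν i := fun hc => hk.ne (Complex.ofReal_injective hc)
    have n3 : (ν k : ℂ) ≠ ν j := fun hc => (hk.trans hj).ne (Complex.ofReal_injective hc)
    rcases hαβ i with a | a <;> rcases hαβ j with b | b <;> rcases hαβ k with c | c <;>
      simp [a, b, c] at n1 n2 n3
  have hmem : star (f i) ⬝ᵥ A.mulVec (f i) ∈ numRange A := ⟨f i, hf1 i, rfl⟩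
  rcases hmm with hm | hm
  · refine mem_frontier_of_max A he hmem ?_
    rintro w ⟨y, hy, rfl⟩
    rw [hval, hform, ← mul_one (ν i), ← hone y hy, Finset.mul_sum]
    exact Finset.sum_le_sum fun k _ => mul_le_mul_of_nonneg_right (hm k) (by positivity)
  · refine mem_frontier_of_max A (neg_ne_zero.2 he) hmem ?_
    rintro w ⟨y, hy, rfl⟩
    rw [neg_mul, neg_mul, Complex.neg_re, Complex.neg_re, neg_le_neg_iff]
    rw [hval, hform, ← mul_one (ν i), ← hone y hy, Finset.mul_sum]
    exact Finset.sum_le_sum fun k _ => mul_le_mul_of_nonneg_right (hm k) (by positivity)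


end

/-- For a unitarily irreducible `A` with `n ≥ 2`: `k(A) = n` iff for some `θ` the Hermitian
matrix `Re(e^{-iθ}A)` has exactly two distinct eigenvalues. -/
theorem gauWu_eq_dim_iff_two_eigenvalues {n : ℕ} (hn : 2 ≤ n)
    (A : Matrix (Fin n) (Fin n) ℂ) (hirr : UnitarilyIrreducible A) :
    gauWu A = n ↔
      ∃ θ : ℝ, ∃ α β : ℂ, α ≠ β ∧
        Module.End.HasEigenvalue
          (Matrix.toLin' (reM (Complex.exp (-(θ : ℂ) * Complex.I) • A))) α ∧
        Module.End.HasEigenvalue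
          (Matrix.toLin' (reM (Complex.exp (-(θ : ℂ) * Complex.I) • A))) β ∧
        ∀ μ : ℂ,
          Module.End.HasEigenvalue
            (Matrix.toLin' (reM (Complex.exp (-(θ : ℂ) * Complex.I) • A))) μ →
          μ = α ∨ μ = β := by

  simp only [hasEig_iff]
  rw [gauWu_eq_iff hn]
  constructor
  · rintro ⟨f, hf, hfr⟩
    exact forward_dir hn A hirr f hf hfr
  · rintro ⟨θ, α, β, -, -, -, h⟩
    exact backward_dir A _ (Complex.exp_ne_zero _) α β h
end
end

section
/- For every n ≥ 5 there exist matrices A, A' ∈ M_n(ℂ), with A unitarily irreducible and A' unitarily reducible, such that F_A = F_{A'} (equal base polynomials), W(A) = W(A'), and k(A) ≠ k(A'); indeed one can take A, A' with k(A) = ⌈n/2⌉ and k(A') = 2. -/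
open Matrix Complex

noncomputable section

/-- The matrix `Im A = (A - A*)/(2i)`. -/
def imM {n : ℕ} (A : Matrix (Fin n) (Fin n) ℂ) : Matrix (Fin n) (Fin n) ℂ :=
  ((2 * Complex.I)⁻¹ : ℂ) • (A - Aᴴ)

/-- The base polynomial of `A`, evaluated at real `(x, y, t)`:
`F_A(x,y,t) = det(x·Re A + y·Im A + t·I)`. -/
def basePoly {n : ℕ} (A : Matrix (Fin n) (Fin n) ℂ) (x y t : ℝ) : ℂ :=
  ((x : ℂ) • reM A + (y : ℂ) • imM A + (t : ℂ) • (1 : Matrix (Fin n) (Fin n) ℂ)).det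

/-- Weighted shift with weights `2 e_{i+1} / (√p_i √p_{i+1})`. -/
def wsM (n : ℕ) (e p : ℕ → ℝ) : Matrix (Fin n) (Fin n) ℂ :=
  Matrix.of fun i j => if (i : ℕ) + 1 = j then ((2 * e j / (√(p i) * √(p j)) : ℝ) : ℂ) else 0

/-- The vector with entries `√p_i Y_i`. -/
def vecP (n : ℕ) (p : ℕ → ℝ) (Y : ℕ → ℂ) : Fin n → ℂ := fun i => ((√(p i) : ℝ) : ℂ) * Y i

lemma exists_vecP {n : ℕ} {p : ℕ → ℝ} (hp : ∀ i < n, 0 < p i) (x : Fin n → ℂ) :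
    ∃ Y, x = vecP n p Y := by
  refine ⟨fun i => if h : i < n then x ⟨i, h⟩ / ((√(p i) : ℝ) : ℂ) else 0, ?_⟩
  ext i
  have h : ((√(p i) : ℝ) : ℂ) ≠ 0 := by
    exact_mod_cast (Real.sqrt_pos.2 (hp i i.2)).ne'
  simp only [vecP, i.2, dif_pos, Fin.eta]
  field_simp

lemma sum_succ_ite {n : ℕ} (i : ℕ) (F : ℕ → ℂ) :
    ∑ j : Fin n, (if i + 1 = (j : ℕ) then F j else 0) = if i + 1 < n then F (i + 1) else 0 := by
  rw [Fin.sum_univ_eq_sum_range (fun j => if i + 1 = j then F j else 0) n]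
  simp

lemma sum_pred_ite {n : ℕ} (i : ℕ) (hi : i < n) (F : ℕ → ℂ) :
    ∑ j : Fin n, (if (j : ℕ) + 1 = i then F j else 0) = if 1 ≤ i then F (i - 1) else 0 := by
  rw [Fin.sum_univ_eq_sum_range (fun j => if j + 1 = i then F j else 0) n]
  rcases i with _ | i
  · simp
  · have : i < n := by omega
    simp [this]

lemma sqrt_ne {n : ℕ} {p : ℕ → ℝ} (hp : ∀ i < n, 0 < p i) {i : ℕ} (hi : i < n) :
    ((√(p i) : ℝ) : ℂ) ≠ 0 := by
  exact_mod_cast (Real.sqrt_pos.2 (hp i hi)).ne'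

lemma sqrt_mul {n : ℕ} {p : ℕ → ℝ} (hp : ∀ i < n, 0 < p i) {i : ℕ} (hi : i < n) :
    ((√(p i) : ℝ) : ℂ) * ((√(p i) : ℝ) : ℂ) = (p i : ℂ) := by
  rw [← Complex.ofReal_mul, Real.mul_self_sqrt (hp i hi).le]

lemma wsM_mulVec {n : ℕ} {e p : ℕ → ℝ} (hp : ∀ i < n, 0 < p i) (hen : e n = 0) (Y : ℕ → ℂ)
    (i : Fin n) : (wsM n e p).mulVec (vecP n p Y) i
      = 2 * (e (i + 1) : ℂ) / ((√(p i) : ℝ) : ℂ) * Y (i + 1) := by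
  have h1 : (wsM n e p).mulVec (vecP n p Y) i = ∑ j : Fin n, (if (i : ℕ) + 1 = (j : ℕ) then
      ((2 * e j / (√(p i) * √(p j)) : ℝ) : ℂ) * (((√(p j) : ℝ) : ℂ) * Y j) else 0) := by
    simp [Matrix.mulVec, dotProduct, wsM, vecP, ite_mul]
  rw [h1, sum_succ_ite (i : ℕ) (fun j => ((2 * e j / (√(p i) * √(p j)) : ℝ) : ℂ) *
    (((√(p j) : ℝ) : ℂ) * Y j))]
  split_ifs with h
  · have h2 := sqrt_ne hp h
    have h3 := sqrt_ne hp i.2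
    push_cast
    field_simp
  · have : (i : ℕ) + 1 = n := by have := i.2; omega
    rw [this, hen]; simp

lemma inner_vecP {n : ℕ} {p : ℕ → ℝ} (hp : ∀ i < n, 0 < p i) (Y Z : ℕ → ℂ) :
    star (vecP n p Y) ⬝ᵥ vecP n p Z
      = ∑ i ∈ Finset.range n, (p i : ℂ) * (star (Y i) * Z i) := by
  rw [← Fin.sum_univ_eq_sum_range (fun i => (p i : ℂ) * (star (Y i) * Z i)) n]
  unfold dotProduct
  refine Finset.sum_congr rfl fun i _ => ?_
  simp only [vecP, Pi.star_apply, star_mul', ← sqrt_mul hp i.2]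
  have : star ((√(p i) : ℝ) : ℂ) = ((√(p i) : ℝ) : ℂ) := Complex.conj_ofReal _
  rw [this]; ring

lemma quad_vecP {n : ℕ} {e p : ℕ → ℝ} (hp : ∀ i < n, 0 < p i) (hen : e n = 0) (Y : ℕ → ℂ) :
    star (vecP n p Y) ⬝ᵥ (wsM n e p).mulVec (vecP n p Y)
      = ∑ i ∈ Finset.range n, (2 * e (i + 1) : ℂ) * (star (Y i) * Y (i + 1)) := by
  rw [← Fin.sum_univ_eq_sum_range (fun i => (2 * e (i + 1) : ℂ) * (star (Y i) * Y (i + 1))) n]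
  unfold dotProduct
  refine Finset.sum_congr rfl fun i _ => ?_
  rw [wsM_mulVec hp hen]
  simp only [vecP, Pi.star_apply, star_mul']
  have : star ((√(p i) : ℝ) : ℂ) = ((√(p i) : ℝ) : ℂ) := Complex.conj_ofReal _
  have h3 := sqrt_ne hp i.2
  rw [this]; field_simp

lemma normSq_diff (u a b : ℂ) (hu : ‖u‖ = 1) :
    Complex.normSq (b - u * a) = Complex.normSq a + Complex.normSq b
      - 2 * (star u * (star a * b)).re := by
  have h : Complex.normSq u = 1 := by rw [Complex.normSq_eq_norm_sq, hu]; norm_num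
  have h2 : star u * (star a * b) = b * star (u * a) := by rw [star_mul']; ring
  rw [Complex.normSq_sub, Complex.normSq_mul, h, h2]
  simp only [Complex.star_def]; ring

lemma energy {n : ℕ} {e p : ℕ → ℝ} (he0 : e 0 = 0) (hen : e n = 0) (Y : ℕ → ℂ) (u : ℂ)
    (hu : ‖u‖ = 1) :
    (∑ i ∈ Finset.range n, (p i : ℂ) * (star (Y i) * Y i)).re
      - (star u * ∑ i ∈ Finset.range n, (2 * e (i + 1) : ℂ) * (star (Y i) * Y (i + 1))).re
    = ∑ i ∈ Finset.range n, (e (i + 1) * Complex.normSq (Y (i + 1) - u * Y i)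
        + (p i - (e i + e (i + 1))) * Complex.normSq (Y i)) := by
  have h1 : (∑ i ∈ Finset.range n, (p i : ℂ) * (star (Y i) * Y i)).re
      = ∑ i ∈ Finset.range n, p i * Complex.normSq (Y i) := by
    rw [Complex.re_sum]
    refine Finset.sum_congr rfl fun i _ => ?_
    rw [Complex.re_ofReal_mul, Complex.star_def, ← Complex.normSq_eq_conj_mul_self,
      Complex.ofReal_re]
  have h2 : (star u * ∑ i ∈ Finset.range n, (2 * e (i + 1) : ℂ) * (star (Y i) * Y (i + 1))).re
      = ∑ i ∈ Finset.range n, e (i + 1) * (2 * (star u * (star (Y i) * Y (i + 1))).re) := by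
    rw [Finset.mul_sum, Complex.re_sum]
    refine Finset.sum_congr rfl fun i _ => ?_
    have : star u * ((2 * e (i + 1) : ℂ) * (star (Y i) * Y (i + 1)))
      = ((2 * e (i + 1) : ℝ) : ℂ) * (star u * (star (Y i) * Y (i + 1))) := by push_cast; ring
    rw [this, Complex.re_ofReal_mul]; ring
  have h3 : ∑ i ∈ Finset.range n, e (i + 1) * Complex.normSq (Y (i + 1))
      = ∑ i ∈ Finset.range n, e i * Complex.normSq (Y i) := by
    have a1 := Finset.sum_range_succ (fun i => e i * Complex.normSq (Y i)) n
    have a2 := Finset.sum_range_succ' (fun i => e i * Complex.normSq (Y i)) n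
    rw [a1] at a2
    simpa [he0, hen] using a2.symm
  rw [h1, h2]
  have h4 : ∀ i, e (i + 1) * Complex.normSq (Y (i + 1) - u * Y i)
        + (p i - (e i + e (i + 1))) * Complex.normSq (Y i)
      = p i * Complex.normSq (Y i) - e (i + 1) * (2 * (star u * (star (Y i) * Y (i + 1))).re)
        + (e (i + 1) * Complex.normSq (Y (i + 1)) - e i * Complex.normSq (Y i)) := by
    intro i; rw [normSq_diff u _ _ hu]; ring
  simp only [h4, Finset.sum_add_distrib, Finset.sum_sub_distrib, h3]
  ring

/-- Data for our weighted shifts: `N` is the support of the extremal vectors. -/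
structure Good (n N : ℕ) (e p : ℕ → ℝ) : Prop where
  hp : ∀ i < n, 0 < p i
  he0 : e 0 = 0
  hen : e n = 0
  heN : e N = 0
  hnn : ∀ i, 0 ≤ e i
  hd : ∀ i < n, e i + e (i + 1) ≤ p i
  hN : N ≤ n
  hN0 : 0 < N
  heq : ∀ i < N, p i = e i + e (i + 1)

lemma Good.norm_le {n N : ℕ} {e p : ℕ → ℝ} (G : Good n N e p) {z : ℂ}
    (hz : z ∈ numRange (wsM n e p)) : ‖z‖ ≤ 1 := by
  obtain ⟨x, hx, rfl⟩ := hz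
  obtain ⟨Y, rfl⟩ := exists_vecP G.hp x
  set z := star (vecP n p Y) ⬝ᵥ (wsM n e p).mulVec (vecP n p Y) with hz
  by_cases h0 : z = 0
  · simp [h0]
  have hn : ‖z‖ ≠ 0 := norm_ne_zero_iff.2 h0
  have hu : ‖z / (‖z‖ : ℂ)‖ = 1 := by
    rw [norm_div, Complex.norm_real, norm_norm, div_self hn]
  have E := energy (p := p) G.he0 G.hen Y _ hu
  rw [← inner_vecP G.hp, hx, ← quad_vecP G.hp G.hen, ← hz] at E
  have h1 : star (z / (‖z‖ : ℂ)) * z = ((‖z‖ : ℝ) : ℂ) := by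
    have hn' : (‖z‖ : ℂ) ≠ 0 := by exact_mod_cast hn
    rw [Complex.star_def, map_div₀, Complex.conj_ofReal, div_mul_eq_mul_div, Complex.conj_mul']
    field_simp
  rw [h1] at E
  simp only [Complex.one_re, Complex.ofReal_re] at E
  have : 0 ≤ 1 - ‖z‖ := by
    rw [E]
    refine Finset.sum_nonneg fun i hi => ?_
    have hi := Finset.mem_range.1 hi
    have := G.hd i hi
    exact add_nonneg (mul_nonneg (G.hnn _) (Complex.normSq_nonneg _))
      (mul_nonneg (by linarith) (Complex.normSq_nonneg _))
  linarith

lemma Good.boundary {n N : ℕ} {e p : ℕ → ℝ} (G : Good n N e p) {Y : ℕ → ℂ}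
    (hY : star (vecP n p Y) ⬝ᵥ vecP n p Y = 1)
    (hz : ‖star (vecP n p Y) ⬝ᵥ (wsM n e p).mulVec (vecP n p Y)‖ = 1) :
    ∃ u : ℂ, ‖u‖ = 1 ∧ ∀ i < n, (e (i + 1) ≠ 0 → Y (i + 1) = u * Y i) ∧
      (e i + e (i + 1) < p i → Y i = 0) := by
  set z := star (vecP n p Y) ⬝ᵥ (wsM n e p).mulVec (vecP n p Y) with hzd
  refine ⟨z, hz, ?_⟩
  have E := energy (p := p) G.he0 G.hen Y _ hz
  rw [← inner_vecP G.hp, hY, ← quad_vecP G.hp G.hen, ← hzd] at E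
  have h1 : star z * z = 1 := by
    rw [Complex.star_def, Complex.conj_mul', hz]; simp
  rw [h1, sub_self] at E
  have hpos1 : ∀ i < n, 0 ≤ e (i + 1) * Complex.normSq (Y (i + 1) - z * Y i) := fun i hi =>
    mul_nonneg (G.hnn _) (Complex.normSq_nonneg _)
  have hpos2 : ∀ i < n, 0 ≤ (p i - (e i + e (i + 1))) * Complex.normSq (Y i) := fun i hi =>
    mul_nonneg (by linarith [G.hd i hi]) (Complex.normSq_nonneg _)
  have E2 := (Finset.sum_eq_zero_iff_of_nonneg (fun i hi => add_nonneg
    (hpos1 i (Finset.mem_range.1 hi)) (hpos2 i (Finset.mem_range.1 hi)))).1 E.symm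
  intro i hi
  have E3 := E2 i (Finset.mem_range.2 hi)
  have a1 := hpos1 i hi
  have a2 := hpos2 i hi
  have b1 : e (i + 1) * Complex.normSq (Y (i + 1) - z * Y i) = 0 := by linarith
  have b2 : (p i - (e i + e (i + 1))) * Complex.normSq (Y i) = 0 := by linarith
  constructor
  · intro h
    have := (mul_eq_zero.1 b1).resolve_left h
    exact sub_eq_zero.1 (Complex.normSq_eq_zero.1 this)
  · intro h
    have := (mul_eq_zero.1 b2).resolve_left (by linarith)
    exact Complex.normSq_eq_zero.1 this

/-- total mass -/
def tot (N : ℕ) (p : ℕ → ℝ) : ℝ := ∑ i ∈ Finset.range N, p i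

/-- test functions -/
def testY (N : ℕ) (p : ℕ → ℝ) (u : ℂ) (c s : ℝ) : ℕ → ℂ := fun i =>
  if i < N then ((c + s * (-1) ^ i) / (√(tot N p) : ℝ) : ℂ) * u ^ i else 0

lemma Good.tot_pos {n N : ℕ} {e p : ℕ → ℝ} (G : Good n N e p) : 0 < tot N p := by
  refine Finset.sum_pos (fun i hi => G.hp i ?_) ⟨0, Finset.mem_range.2 G.hN0⟩
  have := Finset.mem_range.1 hi
  have := G.hN
  omega

lemma Good.poly {n N : ℕ} {e p : ℕ → ℝ} (G : Good n N e p) (z : ℂ) :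
    ∑ i ∈ Finset.range N, (p i : ℂ) * z ^ i
      = (1 + z) * ∑ i ∈ Finset.range N, (e (i + 1) : ℂ) * z ^ i := by
  have h1 : ∑ i ∈ Finset.range N, (p i : ℂ) * z ^ i
      = ∑ i ∈ Finset.range N, ((e i : ℂ) * z ^ i + (e (i + 1) : ℂ) * z ^ i) := by
    refine Finset.sum_congr rfl fun i hi => ?_
    rw [G.heq i (Finset.mem_range.1 hi)]; push_cast; ring
  have a1 := Finset.sum_range_succ (fun i => (e i : ℂ) * z ^ i) N
  have a2 := Finset.sum_range_succ' (fun i => (e i : ℂ) * z ^ i) N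
  rw [a1] at a2
  simp only [G.heN, G.he0, Complex.ofReal_zero, zero_mul, add_zero] at a2
  rw [h1, Finset.sum_add_distrib, a2, add_mul, one_mul, Finset.mul_sum, add_comm]
  congr 1
  exact Finset.sum_congr rfl fun i _ => by ring

lemma sum_cut {n N : ℕ} (h : N ≤ n) (F : ℕ → ℂ) (hF : ∀ i, N ≤ i → F i = 0) :
    ∑ i ∈ Finset.range n, F i = ∑ i ∈ Finset.range N, F i := by
  symm
  refine Finset.sum_subset (Finset.range_mono h) fun i _ hi => hF i ?_
  simpa using hi

lemma Good.test_inner {n N : ℕ} {e p : ℕ → ℝ} (G : Good n N e p) (u w : ℂ) :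
    star (vecP n p (testY N p u 1 0)) ⬝ᵥ vecP n p (testY N p w 1 0)
      = (∑ i ∈ Finset.range N, (p i : ℂ) * (star u * w) ^ i) / (tot N p : ℂ) := by
  rw [inner_vecP G.hp, sum_cut G.hN _ (fun i hi => by simp [testY, not_lt.2 hi]), Finset.sum_div]
  refine Finset.sum_congr rfl fun i hi => ?_
  have hT := G.tot_pos
  have h1 : ((√(tot N p) : ℝ) : ℂ) * ((√(tot N p) : ℝ) : ℂ) = (tot N p : ℂ) := by
    rw [← Complex.ofReal_mul, Real.mul_self_sqrt hT.le]
  have h2 : ((√(tot N p) : ℝ) : ℂ) ≠ 0 := by exact_mod_cast (Real.sqrt_pos.2 hT).ne'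
  have h3 : star ((√(tot N p) : ℝ) : ℂ) = ((√(tot N p) : ℝ) : ℂ) := Complex.conj_ofReal _
  simp only [testY, Finset.mem_range.1 hi, if_true, ← h1, mul_pow, star_mul', star_pow, star_div₀, h3]
  simp
  field_simp

lemma Good.test_norm {n N : ℕ} {e p : ℕ → ℝ} (G : Good n N e p) (u : ℂ) (hu : ‖u‖ = 1) (c s : ℝ)
    (hcs : c ^ 2 + s ^ 2 = 1) :
    star (vecP n p (testY N p u c s)) ⬝ᵥ vecP n p (testY N p u c s) = 1 := by
  rw [inner_vecP G.hp, sum_cut G.hN _ (fun i hi => by simp [testY, not_lt.2 hi])]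
  have hT := G.tot_pos
  have h1 : ((√(tot N p) : ℝ) : ℂ) * ((√(tot N p) : ℝ) : ℂ) = (tot N p : ℂ) := by
    rw [← Complex.ofReal_mul, Real.mul_self_sqrt hT.le]
  have h2 : ((√(tot N p) : ℝ) : ℂ) ≠ 0 := by exact_mod_cast (Real.sqrt_pos.2 hT).ne'
  have h3 : star ((√(tot N p) : ℝ) : ℂ) = ((√(tot N p) : ℝ) : ℂ) := Complex.conj_ofReal _
  have hu1 : star u * u = 1 := by rw [Complex.star_def, Complex.conj_mul', hu]; simp
  have hcs' : (c : ℂ) ^ 2 + (s : ℂ) ^ 2 = 1 := by exact_mod_cast hcs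
  have key : ∀ i ∈ Finset.range N, (p i : ℂ) * (star (testY N p u c s i) * testY N p u c s i)
      = ((p i : ℂ) + 2 * c * s * ((p i : ℂ) * (-1) ^ i)) / (tot N p : ℂ) := by
    intro i hi
    simp only [testY, Finset.mem_range.1 hi, if_true, ← h1, star_mul', star_pow, star_div₀, h3,
      star_add, star_neg, star_one]
    have hc : star (c : ℂ) = c := Complex.conj_ofReal _
    have hs : star (s : ℂ) = s := Complex.conj_ofReal _
    have hui : star u ^ i * u ^ i = 1 := by rw [← mul_pow, hu1, one_pow]
    have hm : ((-1 : ℂ) ^ i) ^ 2 = 1 := by rw [← pow_mul, mul_comm, pow_mul]; simp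
    rw [hc, hs]
    field_simp
    linear_combination (p i : ℂ) * (c + s * (-1) ^ i) ^ 2 * hui + p i * s ^ 2 * hm + p i * hcs'
  rw [Finset.sum_congr rfl key, ← Finset.sum_div, Finset.sum_add_distrib, ← Finset.mul_sum,
    G.poly (-1)]
  have : (tot N p : ℂ) = ∑ i ∈ Finset.range N, (p i : ℂ) := by simp [tot]
  rw [← this]
  have hT' : (tot N p : ℂ) ≠ 0 := by exact_mod_cast hT.ne'
  simp [hT']

lemma Good.test_quad {n N : ℕ} {e p : ℕ → ℝ} (G : Good n N e p) (u : ℂ) (hu : ‖u‖ = 1) (c s : ℝ) :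
    star (vecP n p (testY N p u c s)) ⬝ᵥ (wsM n e p).mulVec (vecP n p (testY N p u c s))
      = (c ^ 2 - s ^ 2) * u := by
  rw [quad_vecP G.hp G.hen, sum_cut G.hN _ (fun i hi => by simp [testY, not_lt.2 hi])]
  have hT := G.tot_pos
  have h1 : ((√(tot N p) : ℝ) : ℂ) * ((√(tot N p) : ℝ) : ℂ) = (tot N p : ℂ) := by
    rw [← Complex.ofReal_mul, Real.mul_self_sqrt hT.le]
  have h2 : ((√(tot N p) : ℝ) : ℂ) ≠ 0 := by exact_mod_cast (Real.sqrt_pos.2 hT).ne'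
  have h3 : star ((√(tot N p) : ℝ) : ℂ) = ((√(tot N p) : ℝ) : ℂ) := Complex.conj_ofReal _
  have hu1 : star u * u = 1 := by rw [Complex.star_def, Complex.conj_mul', hu]; simp
  have key : ∀ i ∈ Finset.range N,
      (2 * e (i + 1) : ℂ) * (star (testY N p u c s i) * testY N p u c s (i + 1))
      = (c ^ 2 - s ^ 2) * u / (tot N p : ℂ) * (2 * (e (i + 1) : ℂ)) := by
    intro i hi
    by_cases hi1 : i + 1 < N
    · simp only [testY, Finset.mem_range.1 hi, hi1, if_true, ← h1, star_mul', star_pow, star_div₀,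
        h3, star_add, star_neg, star_one]
      have hc : star (c : ℂ) = c := Complex.conj_ofReal _
      have hs : star (s : ℂ) = s := Complex.conj_ofReal _
      have hui : star u ^ i * u ^ i = 1 := by rw [← mul_pow, hu1, one_pow]
      have hm : ((-1 : ℂ) ^ i) ^ 2 = 1 := by rw [← pow_mul, mul_comm, pow_mul]; simp
      rw [hc, hs, pow_succ, pow_succ]
      field_simp
      linear_combination (e (i + 1) : ℂ) * u * (c ^ 2 - s ^ 2 * ((-1) ^ i) ^ 2) * hui
        - e (i + 1) * u * s ^ 2 * hm
    · have : i + 1 = N := by have := Finset.mem_range.1 hi; omega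
      simp [this, G.heN]
  rw [Finset.sum_congr rfl key, ← Finset.mul_sum, ← Finset.mul_sum]
  have h4 := G.poly 1
  have : (tot N p : ℂ) = ∑ i ∈ Finset.range N, (p i : ℂ) := by simp [tot]
  simp only [one_pow, mul_one] at h4
  rw [← this] at h4
  have hT' : (tot N p : ℂ) ≠ 0 := by exact_mod_cast hT.ne'
  field_simp
  rw [h4]; ring

lemma Good.numRange_eq {n N : ℕ} {e p : ℕ → ℝ} (G : Good n N e p) :
    numRange (wsM n e p) = Metric.closedBall 0 1 := by
  ext z
  rw [mem_closedBall_zero_iff]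
  refine ⟨G.norm_le, fun hz => ?_⟩
  obtain ⟨u, hu, hzu⟩ : ∃ u : ℂ, ‖u‖ = 1 ∧ z = (‖z‖ : ℂ) * u := by
    by_cases h0 : z = 0
    · exact ⟨1, by simp, by simp [h0]⟩
    · have hn : ‖z‖ ≠ 0 := norm_ne_zero_iff.2 h0
      have hn' : (‖z‖ : ℂ) ≠ 0 := by exact_mod_cast hn
      exact ⟨z / (‖z‖ : ℂ), by rw [norm_div, Complex.norm_real, norm_norm, div_self hn],
        by field_simp⟩
  have hc : √((1 + ‖z‖) / 2) ^ 2 = (1 + ‖z‖) / 2 := Real.sq_sqrt (by positivity)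
  have hs : √((1 - ‖z‖) / 2) ^ 2 = (1 - ‖z‖) / 2 := Real.sq_sqrt (by linarith)
  refine ⟨_, G.test_norm u hu (√((1 + ‖z‖) / 2)) (√((1 - ‖z‖) / 2)) (by rw [hc, hs]; ring), ?_⟩
  rw [G.test_quad u hu, ← Complex.ofReal_pow, ← Complex.ofReal_pow, hc, hs]
  conv_rhs => rw [hzu]
  push_cast; ring

lemma Good.frontier_eq {n N : ℕ} {e p : ℕ → ℝ} (G : Good n N e p) (z : ℂ) :
    z ∈ frontier (numRange (wsM n e p)) ↔ ‖z‖ = 1 := by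
  rw [G.numRange_eq, frontier_closedBall _ one_ne_zero, mem_sphere_zero_iff_norm]

lemma Good.mem_gauWu {n N : ℕ} {e p : ℕ → ℝ} (G : Good n N e p) {k : ℕ} (u : Fin k → ℂ)
    (hu : ∀ i, ‖u i‖ = 1)
    (h : ∀ i j, i ≠ j → ∑ l ∈ Finset.range N, (p l : ℂ) * (star (u i) * u j) ^ l = 0) :
    ∃ f : Fin k → (Fin n → ℂ),
    (∀ i j, star (f i) ⬝ᵥ f j = if i = j then (1 : ℂ) else 0) ∧
    ∀ j, star (f j) ⬝ᵥ (wsM n e p).mulVec (f j) ∈ frontier (numRange (wsM n e p)) := by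
  refine ⟨fun i => vecP n p (testY N p (u i) 1 0), fun i j => ?_, fun j => ?_⟩
  · by_cases hij : i = j
    · subst hij
      simpa using G.test_norm (u i) (hu i) 1 0 (by norm_num)
    · rw [G.test_inner, h i j hij, if_neg hij, zero_div]
  · rw [G.frontier_eq, G.test_quad _ (hu j)]
    simp [hu j]

/-- the tridiagonal matrix similar to the pencil -/
def kMat (n : ℕ) (e p : ℕ → ℝ) : Matrix (Fin n) (Fin n) ℂ :=
  Matrix.of fun i j => (if (i : ℕ) + 1 = j then (e j / p i : ℂ) else 0)
    + (if (j : ℕ) + 1 = i then (e i / p i : ℂ) else 0)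

lemma kMat_mulVec {n : ℕ} {e p : ℕ → ℝ} (he0 : e 0 = 0) (hen : e n = 0) (Y : ℕ → ℂ) (i : Fin n) :
    (kMat n e p).mulVec (fun j => Y j) i
      = ((e (i + 1) : ℂ) * Y (i + 1) + (e i : ℂ) * Y (i - 1)) / (p i : ℂ) := by
  have h1 : (kMat n e p).mulVec (fun j => Y j) i
      = ∑ j : Fin n, (if (i : ℕ) + 1 = (j : ℕ) then (e j / p i : ℂ) * Y j else 0)
        + ∑ j : Fin n, (if (j : ℕ) + 1 = (i : ℕ) then (e i / p i : ℂ) * Y j else 0) := by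
    simp [Matrix.mulVec, dotProduct, kMat, add_mul, ite_mul, Finset.sum_add_distrib]
  rw [h1, sum_succ_ite (i : ℕ) (fun j => (e j / p i : ℂ) * Y j),
    sum_pred_ite (i : ℕ) i.2 (fun j => (e i / p i : ℂ) * Y j)]
  have a1 : (if (i : ℕ) + 1 < n then (e (i + 1) / p i : ℂ) * Y (i + 1) else 0)
      = (e (i + 1) / p i : ℂ) * Y (i + 1) := by
    split_ifs with h
    · rfl
    · have : (i : ℕ) + 1 = n := by have := i.2; omega
      rw [this, hen]; simp
  have a2 : (if 1 ≤ (i : ℕ) then (e i / p i : ℂ) * Y (i - 1) else 0)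
      = (e i / p i : ℂ) * Y (i - 1) := by
    split_ifs with h
    · rfl
    · have : (i : ℕ) = 0 := by omega
      rw [this, he0]; simp
  rw [a1, a2]; ring

lemma det_eq_of_intertwine {n : ℕ} {S M M' : Matrix (Fin n) (Fin n) ℂ} (hS : S.det ≠ 0)
    (h : S * M = M' * S) : M.det = M'.det := by
  have := congrArg Matrix.det h
  rw [Matrix.det_mul, Matrix.det_mul, mul_comm M'.det] at this
  exact mul_left_cancel₀ hS this

lemma basePoly_wsM {n : ℕ} {e p : ℕ → ℝ} (hp : ∀ i < n, 0 < p i) (x y t : ℝ) :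
    basePoly (wsM n e p) x y t
      = (((‖(⟨x, y⟩ : ℂ)‖ : ℝ) : ℂ) • kMat n e p + (t : ℂ) • (1 : Matrix (Fin n) (Fin n) ℂ)).det := by
  set w : ℂ := ⟨x, y⟩ with hw
  obtain ⟨u, hu, hwu⟩ : ∃ u : ℂ, ‖u‖ = 1 ∧ w = (‖w‖ : ℂ) * u := by
    by_cases h0 : w = 0
    · exact ⟨1, by simp, by simp [h0]⟩
    · have hn : ‖w‖ ≠ 0 := norm_ne_zero_iff.2 h0
      have hn' : (‖w‖ : ℂ) ≠ 0 := by exact_mod_cast hn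
      exact ⟨w / (‖w‖ : ℂ), by rw [norm_div, Complex.norm_real, norm_norm, div_self hn],
        by field_simp⟩
  have hu1 : star u * u = 1 := by rw [Complex.star_def, Complex.conj_mul', hu]; simp
  have hu0 : u ≠ 0 := by intro h; simp [h] at hu
  set r : ℂ := ((‖w‖ : ℝ) : ℂ) with hr
  have hw1 : (x : ℂ) + y * Complex.I = r * u := by
    rw [← hwu, hw]; exact (Complex.mk_eq_add_mul_I x y).symm
  have hw2 : (x : ℂ) - y * Complex.I = r * star u := by
    have := congrArg star hw1
    simp only [star_add, star_mul', Complex.star_def, Complex.conj_ofReal, Complex.conj_I, hr]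
      at this ⊢
    rw [← this]; ring
  unfold basePoly
  have hcomb : (x : ℂ) • reM (wsM n e p) + (y : ℂ) • imM (wsM n e p)
      = (r * star u / 2) • wsM n e p + (r * u / 2) • (wsM n e p)ᴴ := by
    ext i j
    simp only [reM, imM, Matrix.add_apply, Matrix.smul_apply, Matrix.sub_apply, smul_eq_mul,
      ← hw1, ← hw2, mul_inv, Complex.inv_I]
    ring
  rw [hcomb]
  symm
  apply det_eq_of_intertwine (S := Matrix.diagonal fun i : Fin n => ((√(p i) : ℝ) : ℂ) * u ^ (i : ℕ))
  · rw [Matrix.det_diagonal]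
    exact Finset.prod_ne_zero_iff.2 fun i _ => mul_ne_zero (sqrt_ne hp i.2) (pow_ne_zero _ hu0)
  · ext i j
    rw [Matrix.diagonal_mul, Matrix.mul_diagonal]
    simp only [Matrix.add_apply, Matrix.smul_apply, smul_eq_mul, kMat, wsM, Matrix.of_apply,
      Matrix.conjTranspose_apply, Matrix.one_apply]
    have hi := sqrt_ne hp i.2
    have hj := sqrt_ne hp j.2
    have mi := sqrt_mul hp i.2
    by_cases h1 : (i : ℕ) + 1 = j
    · have h2 : ¬ ((j : ℕ) + 1 = i) := by omega
      have h3 : i ≠ j := by rintro rfl; omega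
      rw [if_pos h1, if_neg h2, if_neg h3, ← mi, ← h1]
      rw [← h1] at hj
      rw [if_pos rfl, if_neg (by omega), pow_succ]
      push_cast
      simp only [star_zero]
      field_simp
      linear_combination (-2 : ℂ) * r * e (i + 1) * hu1
    · by_cases h2 : (j : ℕ) + 1 = i
      · have h3 : i ≠ j := by rintro rfl; omega
        rw [if_neg h1, if_pos h2, if_neg h3, ← mi, ← h2]
        rw [← h2] at hi
        rw [if_pos rfl, if_neg (by omega), pow_succ]
        have : star ((2 * e (j + 1) / (√(p j) * √(p (j + 1))) : ℝ) : ℂ)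
          = ((2 * e (j + 1) / (√(p j) * √(p (j + 1))) : ℝ) : ℂ) := Complex.conj_ofReal _
        rw [this]
        push_cast
        field_simp
        ring
      · by_cases h3 : i = j
        · subst h3; simp [mul_comm]
        · simp [h1, h2, h3]

/-- dual data -/
def eD (n : ℕ) (e : ℕ → ℝ) (i : ℕ) : ℝ :=
  if i = 1 then 1 else if 3 ≤ i ∧ i < n then (e (i - 1))⁻¹ else 0

/-- dual data -/
def pD (e : ℕ → ℝ) (i : ℕ) : ℝ := if i < 2 then 1 else (e (i - 1))⁻¹ + (e i)⁻¹

/-- the intertwiner (Darboux transformation) -/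
def sMat (n : ℕ) (p p' : ℕ → ℝ) : Matrix (Fin n) (Fin n) ℂ :=
  Matrix.of fun i j => if (i : ℕ) < 2 then (if (j : ℕ) % 2 = i then (p j : ℂ) else 0)
    else ((if (i : ℕ) = j then 1 else 0) - (if (j : ℕ) + 1 = (i : ℕ) - 1 then 1 else 0)) / (p' i : ℂ)

/-- the intertwiner on functions on `ℕ` -/
def sFun (n : ℕ) (p p' : ℕ → ℝ) (Y : ℕ → ℂ) (i : ℕ) : ℂ :=
  if i < 2 then ∑ j ∈ Finset.range n, (if j % 2 = i then (p j : ℂ) * Y j else 0)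
  else (Y i - Y (i - 2)) / (p' i : ℂ)

lemma sMat_mulVec {n : ℕ} {p p' : ℕ → ℝ} (Y : ℕ → ℂ) (i : Fin n) :
    (sMat n p p').mulVec (fun j => Y j) i = sFun n p p' Y i := by
  by_cases h : (i : ℕ) < 2
  · simp only [Matrix.mulVec, dotProduct, sMat, sFun, h, if_true, Matrix.of_apply, ite_mul, zero_mul]
    rw [Fin.sum_univ_eq_sum_range (fun j => if j % 2 = (i : ℕ) then (p j : ℂ) * Y j else 0) n]
  · simp only [Matrix.mulVec, dotProduct, sMat, sFun, h, if_false, Matrix.of_apply]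
    have h1 : ∀ j : Fin n, ((if (i : ℕ) = j then (1 : ℂ) else 0)
        - (if (j : ℕ) + 1 = (i : ℕ) - 1 then 1 else 0)) / (p' i : ℂ) * Y j
        = ((if (i : ℕ) = j then Y j else 0) - (if (j : ℕ) + 1 = (i : ℕ) - 1 then Y j else 0))
          / (p' i : ℂ) := by
      intro j; split_ifs <;> ring
    simp only [h1]
    have hi := i.2
    rw [← Finset.sum_div, Finset.sum_sub_distrib, sum_pred_ite ((i : ℕ) - 1) (by omega) Y,
      Fin.sum_univ_eq_sum_range (fun j => if (i : ℕ) = j then Y j else 0) n]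
    have h2 : 1 ≤ (i : ℕ) - 1 := by omega
    simp [h2, Nat.sub_sub]

/-- Basic hypotheses on `e`. -/
structure Base (n : ℕ) (e : ℕ → ℝ) : Prop where
  hn : 5 ≤ n
  he0 : e 0 = 0
  hpos : ∀ i, 1 ≤ i → i < n → 0 < e i
  hzero : ∀ i, n ≤ i → e i = 0

/-- The function `p`. -/
def pE (e : ℕ → ℝ) (i : ℕ) : ℝ := e i + e (i + 1)

lemma Base.nonneg {n : ℕ} {e : ℕ → ℝ} (B : Base n e) (i : ℕ) : 0 ≤ e i := by
  by_cases h0 : i = 0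
  · rw [h0, B.he0]
  by_cases h : i < n
  · exact (B.hpos i (by omega) h).le
  · rw [B.hzero i (by omega)]

lemma Base.pE_pos {n : ℕ} {e : ℕ → ℝ} (B : Base n e) : ∀ i < n, 0 < pE e i := by
  intro i hi
  have h1 := B.nonneg i
  have h2 := B.nonneg (i + 1)
  have hn := B.hn
  unfold pE
  by_cases h : i = 0
  · have := B.hpos (i + 1) (by omega) (by omega); linarith
  · have := B.hpos i (by omega) (by omega); linarith

lemma Base.good {n : ℕ} {e : ℕ → ℝ} (B : Base n e) : Good n n e (pE e) where
  hp := B.pE_pos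
  he0 := B.he0
  hen := B.hzero n le_rfl
  heN := B.hzero n le_rfl
  hnn := B.nonneg
  hd := fun i _ => le_rfl
  hN := le_rfl
  hN0 := by have := B.hn; omega
  heq := fun i _ => rfl

lemma Base.eD_nonneg {n : ℕ} {e : ℕ → ℝ} (B : Base n e) (i : ℕ) : 0 ≤ eD n e i := by
  unfold eD
  split_ifs
  · norm_num
  · exact inv_nonneg.2 (B.nonneg _)
  · exact le_rfl

lemma Base.pD_pos {n : ℕ} {e : ℕ → ℝ} (B : Base n e) : ∀ i < n, 0 < pD e i := by
  intro i hi
  unfold pD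
  split_ifs with h
  · norm_num
  · have := inv_pos.2 (B.hpos i (by omega) hi)
    have := inv_pos.2 (B.hpos (i - 1) (by omega) (by omega))
    linarith

lemma Base.goodD {n : ℕ} {e : ℕ → ℝ} (B : Base n e) : Good n 2 (eD n e) (pD e) where
  hp := B.pD_pos
  he0 := by simp [eD]
  hen := by have := B.hn; simp only [eD]; rw [if_neg (by omega), if_neg (by omega)]
  heN := by simp [eD]
  hnn := B.eD_nonneg
  hd := by
    intro i hi
    have hn := B.hn
    rcases Nat.lt_or_ge i 2 with h | h
    · interval_cases i <;> simp [eD, pD]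
    · have h1 : eD n e i ≤ (e (i - 1))⁻¹ := by
        unfold eD
        rw [if_neg (by omega)]
        split_ifs
        · exact le_rfl
        · exact inv_nonneg.2 (B.nonneg _)
      have h2 : eD n e (i + 1) ≤ (e i)⁻¹ := by
        unfold eD
        rw [if_neg (by omega)]
        split_ifs
        · simp
        · exact inv_nonneg.2 (B.nonneg _)
      unfold pD
      rw [if_neg (by omega)]
      linarith
  hN := by have := B.hn; omega
  hN0 := by norm_num
  heq := by
    intro i hi
    interval_cases i <;> simp [eD, pD]

lemma sum_shift_up {n : ℕ} (g : ℕ → ℂ) (h0 : g 0 = 0) (hn : g n = 0) :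
    ∑ i ∈ Finset.range n, g (i + 1) = ∑ i ∈ Finset.range n, g i := by
  have a1 := Finset.sum_range_succ g n
  have a2 := Finset.sum_range_succ' g n
  rw [a1] at a2
  simpa [h0, hn] using a2.symm

/-- the operator of `kMat` on functions on `ℕ` -/
def kFun (e p : ℕ → ℝ) (Y : ℕ → ℂ) (i : ℕ) : ℂ :=
  ((e (i + 1) : ℂ) * Y (i + 1) + (e i : ℂ) * Y (i - 1)) / (p i : ℂ)

lemma Base.swap {n : ℕ} {e : ℕ → ℝ} (B : Base n e) (Y : ℕ → ℂ) (a b : ℕ) (hab : a + b = 1) :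
    ∑ j ∈ Finset.range n, (if j % 2 = a then (pE e j : ℂ) * kFun e (pE e) Y j else 0)
      = ∑ j ∈ Finset.range n, (if j % 2 = b then (pE e j : ℂ) * Y j else 0) := by
  have hen := B.hzero n le_rfl
  have h1 : ∀ j ∈ Finset.range n,
      (if j % 2 = a then (pE e j : ℂ) * kFun e (pE e) Y j else 0)
      = (if (j + 1) % 2 = b then (e (j + 1) : ℂ) * Y (j + 1) else 0)
        + (if j % 2 = a then (e j : ℂ) * Y (j - 1) else 0) := by
    intro j hj
    have hp : (pE e j : ℂ) ≠ 0 := by exact_mod_cast (B.pE_pos j (Finset.mem_range.1 hj)).ne'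
    by_cases h : j % 2 = a
    · rw [if_pos h, if_pos h, if_pos (by omega)]
      unfold kFun
      field_simp
    · rw [if_neg h, if_neg h, if_neg (by omega)]; simp
  rw [Finset.sum_congr rfl h1, Finset.sum_add_distrib,
    sum_shift_up (fun j => if j % 2 = b then (e j : ℂ) * Y j else 0) (by simp [B.he0])
      (by simp [hen]),
    ← sum_shift_up (fun j => if j % 2 = a then (e j : ℂ) * Y (j - 1) else 0) (by simp [B.he0])
      (by simp [hen]), ← Finset.sum_add_distrib]
  refine Finset.sum_congr rfl fun j _ => ?_
  by_cases h : j % 2 = b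
  · rw [if_pos h, if_pos (by omega), if_pos h]
    simp only [Nat.add_sub_cancel, pE]; push_cast; ring
  · rw [if_neg h, if_neg (by omega), if_neg h]; simp

lemma inv_identity {a b y : ℂ} (ha : a ≠ 0) (hb : b ≠ 0) (hab : a + b ≠ 0) :
    a⁻¹ * (y / (a⁻¹ + b⁻¹)) = b * y / (a + b) := by
  have : a⁻¹ + b⁻¹ = (a + b) / (a * b) := by field_simp; ring
  rw [this]
  field_simp

lemma Base.intertwine_fun {n : ℕ} {e : ℕ → ℝ} (B : Base n e) (Y : ℕ → ℂ) (i : ℕ) (hi : i < n) :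
    sFun n (pE e) (pD e) (kFun e (pE e) Y) i
      = kFun (eD n e) (pD e) (sFun n (pE e) (pD e) Y) i := by
  have hn := B.hn
  rcases Nat.lt_or_ge i 2 with h | h
  · interval_cases i
    · have := B.swap Y 0 1 rfl
      simp only [sFun, kFun] at this ⊢
      simp [eD, pD, this]
    · have := B.swap Y 1 0 rfl
      simp only [sFun, kFun] at this ⊢
      simp [eD, pD, this]
  · have hpi := B.pE_pos i hi
    have hpi2 := B.pE_pos (i - 2) (by omega)
    have hD := B.pD_pos i hi
    have k1 : sFun n (pE e) (pD e) (kFun e (pE e) Y) i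
        = (kFun e (pE e) Y i - kFun e (pE e) Y (i - 2)) / (pD e i : ℂ) := by
      unfold sFun; rw [if_neg (by omega)]
    rw [k1]
    conv_rhs => unfold kFun
    congr 1
    have c1 : (eD n e (i + 1) : ℂ) * sFun n (pE e) (pD e) Y (i + 1)
        = (e (i + 1) : ℂ) * (Y (i + 1) - Y (i - 1)) / (pE e i : ℂ) := by
      by_cases hl : i + 1 < n
      · have e1 := B.hpos i (by omega) hi
        have e2 := B.hpos (i + 1) (by omega) hl
        have e1' : (e i : ℂ) ≠ 0 := by exact_mod_cast e1.ne'
        have e2' : (e (i + 1) : ℂ) ≠ 0 := by exact_mod_cast e2.ne'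
        have e3' : (e i : ℂ) + e (i + 1) ≠ 0 := by exact_mod_cast (by linarith : e i + e (i+1) ≠ 0)
        unfold eD sFun pD pE
        rw [if_neg (by omega), if_pos (by omega), if_neg (by omega), if_neg (by omega)]
        have : i + 1 - 2 = i - 1 := by omega
        rw [this, Nat.add_sub_cancel]
        push_cast
        exact inv_identity e1' e2' e3'
      · have : e (i + 1) = 0 := B.hzero _ (by omega)
        have h2 : eD n e (i + 1) = 0 := by
          unfold eD; rw [if_neg (by omega), if_neg (by omega)]
        rw [this, h2]; simp
    have c2 : (eD n e i : ℂ) * sFun n (pE e) (pD e) Y (i - 1)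
        = (e (i - 2) : ℂ) * (Y (i - 1) - Y (i - 2 - 1)) / (pE e (i - 2) : ℂ) := by
      by_cases hl : 3 ≤ i
      · obtain ⟨k, rfl⟩ : ∃ k, i = k + 3 := ⟨i - 3, by omega⟩
        have e1 := B.hpos (k + 1) (by omega) (by omega)
        have e2 := B.hpos (k + 2) (by omega) (by omega)
        have e1' : (e (k + 1) : ℂ) ≠ 0 := by exact_mod_cast e1.ne'
        have e2' : (e (k + 2) : ℂ) ≠ 0 := by exact_mod_cast e2.ne'
        have e3' : (e (k + 1) : ℂ) + e (k + 2) ≠ 0 := by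
          exact_mod_cast (by linarith : e (k + 1) + e (k + 2) ≠ 0)
        have s1 : k + 3 - 1 = k + 2 := rfl
        have s2 : k + 3 - 2 = k + 1 := rfl
        have s3 : k + 2 - 2 = k := rfl
        have s4 : k + 1 - 1 = k := rfl
        have s5 : k + 2 - 1 = k + 1 := rfl
        unfold eD sFun pD pE
        rw [if_neg (by omega), if_pos (by omega), if_neg (by omega), if_neg (by omega)]
        rw [s1, s2, s3, s4, s5]
        push_cast
        rw [add_comm (e (k + 1) : ℂ)⁻¹, inv_identity e2' e1' (by rwa [add_comm]),
          add_comm (e (k + 2) : ℂ)]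
      · have : i = 2 := by omega
        subst this
        simp [eD, B.he0]
    rw [c1, c2]
    unfold kFun
    have s1 : i - 2 + 1 = i - 1 := by omega
    rw [s1]
    have p1 : (e i : ℂ) = pE e i - e (i + 1) := by simp [pE]
    have p2 : (e (i - 1) : ℂ) = pE e (i - 2) - e (i - 2) := by simp [pE, s1]
    have q1 : (pE e i : ℂ) ≠ 0 := by exact_mod_cast hpi.ne'
    have q2 : (pE e (i - 2) : ℂ) ≠ 0 := by exact_mod_cast hpi2.ne'
    rw [p1, p2]
    field_simp
    ring

lemma exists_ext {n : ℕ} (y : Fin n → ℂ) : ∃ Y : ℕ → ℂ, y = fun j : Fin n => Y j :=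
  ⟨fun i => if h : i < n then y ⟨i, h⟩ else 0, by ext j; simp⟩

lemma Base.intertwine {n : ℕ} {e : ℕ → ℝ} (B : Base n e) :
    sMat n (pE e) (pD e) * kMat n e (pE e) = kMat n (eD n e) (pD e) * sMat n (pE e) (pD e) := by
  apply Matrix.ext_of_mulVec_single
  intro j
  obtain ⟨Y, hY⟩ := exists_ext (Pi.single j (1 : ℂ))
  rw [hY, ← Matrix.mulVec_mulVec, ← Matrix.mulVec_mulVec]
  have G := B.good
  have G' := B.goodD
  have h1 : (kMat n e (pE e)).mulVec (fun j => Y j) = fun j : Fin n => kFun e (pE e) Y j := by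
    ext i; exact kMat_mulVec G.he0 G.hen Y i
  have h2 : (sMat n (pE e) (pD e)).mulVec (fun j => Y j)
      = fun j : Fin n => sFun n (pE e) (pD e) Y j := by
    ext i; exact sMat_mulVec Y i
  rw [h1, h2]
  ext i
  rw [sMat_mulVec, kMat_mulVec G'.he0 G'.hen]
  exact B.intertwine_fun Y i i.2

lemma Base.sMat_det {n : ℕ} {e : ℕ → ℝ} (B : Base n e) : (sMat n (pE e) (pD e)).det ≠ 0 := by
  intro h
  obtain ⟨y, hy0, hy⟩ := Matrix.exists_mulVec_eq_zero_iff.2 h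
  obtain ⟨Y, rfl⟩ := exists_ext y
  have hn := B.hn
  have h1 : ∀ i < n, sFun n (pE e) (pD e) Y i = 0 := by
    intro i hi
    have := congrFun hy ⟨i, hi⟩
    rwa [sMat_mulVec] at this
  have h2 : ∀ i, i + 2 < n → Y (i + 2) = Y i := by
    intro i hi
    have := h1 (i + 2) hi
    unfold sFun at this
    rw [if_neg (by omega)] at this
    have hp : (pD e (i + 2) : ℂ) ≠ 0 := by exact_mod_cast (B.pD_pos _ hi).ne'
    have := (div_eq_zero_iff.1 this).resolve_right hp
    exact sub_eq_zero.1 this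
  have h3 : ∀ i < n, Y i = Y (i % 2) := by
    intro i
    induction i using Nat.strong_induction_on with
    | _ i ih =>
      intro hi
      rcases Nat.lt_or_ge i 2 with h | h
      · rw [Nat.mod_eq_of_lt h]
      · obtain ⟨k, rfl⟩ : ∃ k, i = k + 2 := ⟨i - 2, by omega⟩
        rw [h2 k hi, ih k (by omega) (by omega), Nat.add_mod_right]
  have h4 : ∀ a < 2, Y a = 0 := by
    intro a ha
    have := h1 a (by omega)
    unfold sFun at this
    rw [if_pos ha] at this
    have h5 : ∀ j ∈ Finset.range n, (if j % 2 = a then (pE e j : ℂ) * Y j else 0)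
        = ((if j % 2 = a then pE e j else 0 : ℝ) : ℂ) * Y a := by
      intro j hj
      split_ifs with hja
      · rw [h3 j (Finset.mem_range.1 hj), hja]
      · simp
    rw [Finset.sum_congr rfl h5, ← Finset.sum_mul, ← Complex.ofReal_sum] at this
    refine (mul_eq_zero.1 this).resolve_left ?_
    have : 0 < ∑ j ∈ Finset.range n, (if j % 2 = a then pE e j else 0 : ℝ) := by
      refine Finset.sum_pos' (fun j hj => ?_) ⟨a, Finset.mem_range.2 (by omega), ?_⟩
      · split_ifs
        · exact (B.pE_pos j (Finset.mem_range.1 hj)).le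
        · exact le_rfl
      · rw [if_pos (Nat.mod_eq_of_lt ha)]
        exact B.pE_pos a (by omega)
    exact_mod_cast this.ne'
  apply hy0
  ext i
  simp only [Pi.zero_apply]
  rw [h3 i i.2]
  exact h4 _ (Nat.mod_lt _ (by norm_num))

lemma Base.basePoly_eq {n : ℕ} {e : ℕ → ℝ} (B : Base n e) (x y t : ℝ) :
    basePoly (wsM n e (pE e)) x y t = basePoly (wsM n (eD n e) (pD e)) x y t := by
  rw [basePoly_wsM B.good.hp, basePoly_wsM B.goodD.hp]
  apply det_eq_of_intertwine B.sMat_det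
  rw [Matrix.mul_add, Matrix.add_mul, Matrix.mul_smul, Matrix.smul_mul, B.intertwine,
    Matrix.mul_smul, Matrix.smul_mul, Matrix.mul_one, Matrix.one_mul]

lemma wsM_mulVec' {n : ℕ} {e p : ℕ → ℝ} (Y : ℕ → ℂ)
    (i : Fin n) : (wsM n e p).mulVec (fun j => Y j) i
      = if (i : ℕ) + 1 < n then
        ((2 * e (i + 1) / (√(p i) * √(p (i + 1))) : ℝ) : ℂ) * Y (i + 1) else 0 := by
  have h1 : (wsM n e p).mulVec (fun j => Y j) i = ∑ j : Fin n, (if (i : ℕ) + 1 = (j : ℕ) then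
      ((2 * e j / (√(p i) * √(p j)) : ℝ) : ℂ) * Y j else 0) := by
    simp [Matrix.mulVec, dotProduct, wsM, ite_mul]
  rw [h1, sum_succ_ite (i : ℕ) (fun j => ((2 * e j / (√(p i) * √(p j)) : ℝ) : ℂ) * Y j)]

lemma wsM_star_mulVec {n : ℕ} {e p : ℕ → ℝ} (Y : ℕ → ℂ)
    (i : Fin n) : (wsM n e p)ᴴ.mulVec (fun j => Y j) i
      = if 1 ≤ (i : ℕ) then
        ((2 * e i / (√(p (i - 1)) * √(p i)) : ℝ) : ℂ) * Y (i - 1) else 0 := by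
  have h1 : (wsM n e p)ᴴ.mulVec (fun j => Y j) i = ∑ j : Fin n, (if (j : ℕ) + 1 = (i : ℕ) then
      ((2 * e i / (√(p j) * √(p i)) : ℝ) : ℂ) * Y j else 0) := by
    unfold Matrix.mulVec dotProduct
    refine Finset.sum_congr rfl fun j _ => ?_
    simp only [Matrix.conjTranspose_apply, wsM, Matrix.of_apply]
    split_ifs
    · rw [Complex.star_def, Complex.conj_ofReal]
    · simp
  rw [h1, sum_pred_ite (i : ℕ) i.2 (fun j => ((2 * e i / (√(p j) * √(p i)) : ℝ) : ℂ) * Y j)]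

lemma Base.irred {n : ℕ} {e : ℕ → ℝ} (B : Base n e) :
    UnitarilyIrreducible (wsM n e (pE e)) := by
  rintro ⟨L, hL0, hLn, hA, hAs⟩
  have hn := B.hn
  have wpos : ∀ i, i + 1 < n →
      ((2 * e (i + 1) / (√(pE e i) * √(pE e (i + 1))) : ℝ) : ℂ) ≠ 0 := by
    intro i hi
    have h1 := B.hpos (i + 1) (by omega) hi
    have h2 := Real.sqrt_pos.2 (B.pE_pos i (by omega))
    have h3 := Real.sqrt_pos.2 (B.pE_pos (i + 1) hi)
    have : 0 < 2 * e (i + 1) / (√(pE e i) * √(pE e (i + 1))) := by positivity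
    exact_mod_cast this.ne'
  have down : ∀ k : ℕ, ∀ Y : ℕ → ℂ, (fun j : Fin n => Y j) ∈ L → (∃ j < n, Y j ≠ 0) →
      (∀ j < n, k < j → Y j = 0) → (fun j : Fin n => if (j : ℕ) = 0 then (1 : ℂ) else 0) ∈ L := by
    intro k
    induction k with
    | zero =>
      rintro Y hY ⟨j, hj, hj0⟩ hz
      have hj1 : j = 0 := by
        by_contra h
        exact hj0 (hz j hj (by omega))
      subst hj1
      have : (fun j : Fin n => if (j : ℕ) = 0 then (1 : ℂ) else 0)
          = (Y 0)⁻¹ • (fun j : Fin n => Y j) := by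
        ext j
        simp only [Pi.smul_apply, smul_eq_mul]
        split_ifs with h
        · rw [h, inv_mul_cancel₀ hj0]
        · rw [hz j j.2 (by omega), mul_zero]
      rw [this]
      exact L.smul_mem _ hY
    | succ k ih =>
      intro Y hY hex hz
      by_cases hk : k + 1 < n ∧ Y (k + 1) ≠ 0
      · have hm := hA _ hY
        obtain ⟨Z, hZ⟩ := exists_ext ((wsM n e (pE e)).mulVec fun j => Y j)
        have hZ' : ∀ i (hi : i < n), Z i = if i + 1 < n then
          ((2 * e (i + 1) / (√(pE e i) * √(pE e (i + 1))) : ℝ) : ℂ) * Y (i + 1) else 0 := by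
          intro i hi
          rw [← wsM_mulVec' Y ⟨i, hi⟩, hZ]
        rw [hZ] at hm
        refine ih Z hm ⟨k, by omega, ?_⟩ ?_
        · rw [hZ' k (by omega), if_pos hk.1]
          exact mul_ne_zero (wpos k hk.1) hk.2
        · intro j hj hkj
          rw [hZ' j hj]
          split_ifs with h
          · rw [hz (j + 1) h (by omega), mul_zero]
          · rfl
      · refine ih Y hY hex ?_
        intro j hj hkj
        by_cases hjk : j = k + 1
        · subst hjk
          by_contra h
          exact hk ⟨hj, h⟩
        · exact hz j hj (by omega)
  have h0 : (fun j : Fin n => if (j : ℕ) = 0 then (1 : ℂ) else 0) ∈ L := by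
    have hne : L ≠ ⊥ := by
      rintro rfl
      simp at hL0
    obtain ⟨x, hx, hx0⟩ := (Submodule.ne_bot_iff L).1 hne
    obtain ⟨Y, rfl⟩ := exists_ext x
    refine down n Y hx ?_ (fun j hj hj' => by omega)
    by_contra hcon
    push Not at hcon
    exact hx0 (by ext j; exact hcon j j.2)
  have hall : ∀ k < n, (fun j : Fin n => if (j : ℕ) = k then (1 : ℂ) else 0) ∈ L := by
    intro k
    induction k with
    | zero => intro _; exact h0
    | succ k ih =>
      intro hk
      have hm := hAs _ (ih (by omega))
      have h1 : (fun j : Fin n => if (j : ℕ) = k + 1 then (1 : ℂ) else 0)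
          = (((2 * e (k + 1) / (√(pE e k) * √(pE e (k + 1))) : ℝ) : ℂ))⁻¹ •
            ((wsM n e (pE e))ᴴ.mulVec (fun j : Fin n => if (j : ℕ) = k then (1 : ℂ) else 0)) := by
        ext j
        simp only [Pi.smul_apply, smul_eq_mul]
        rw [wsM_star_mulVec (fun j => if j = k then (1 : ℂ) else 0)]
        by_cases h : (j : ℕ) = k + 1
        · rw [if_pos h, if_pos (by omega), if_pos (by omega), h, Nat.add_sub_cancel, mul_one,
            inv_mul_cancel₀ (wpos k hk)]
        · rw [if_neg h]
          by_cases h' : 1 ≤ (j : ℕ)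
          · rw [if_pos h', if_neg (by omega)]; simp
          · rw [if_neg h']; simp
      rw [h1]
      exact L.smul_mem _ hm
  have htop : L = ⊤ := by
    rw [eq_top_iff]
    intro x _
    have : x = ∑ k : Fin n, x k • (fun j : Fin n => if (j : ℕ) = (k : ℕ) then (1 : ℂ) else 0) := by
      ext j
      simp [Finset.sum_apply, Fin.val_inj]
    rw [this]
    exact L.sum_mem fun k _ => L.smul_mem _ (hall k k.2)
  rw [htop] at hLn
  simp at hLn

lemma Base.red {n : ℕ} {e : ℕ → ℝ} (B : Base n e) :
    ¬ UnitarilyIrreducible (wsM n (eD n e) (pD e)) := by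
  have hn := B.hn
  unfold UnitarilyIrreducible
  rw [not_not]
  let L : Submodule ℂ (Fin n → ℂ) :=
    { carrier := {x | ∀ j : Fin n, 2 ≤ (j : ℕ) → x j = 0}
      add_mem' := fun {a b} ha hb j hj => by simp [ha j hj, hb j hj]
      zero_mem' := fun j _ => rfl
      smul_mem' := fun c x hx j hj => by simp [hx j hj] }
  have hL : ∀ x, x ∈ L ↔ ∀ j : Fin n, 2 ≤ (j : ℕ) → x j = 0 := fun x => Iff.rfl
  have e2 : eD n e 2 = 0 := by simp [eD]
  refine ⟨L, ?_, ?_, ?_, ?_⟩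
  · rw [Nat.pos_iff_ne_zero, Ne, Submodule.finrank_eq_zero]
    intro h
    have : (Pi.single (⟨0, by omega⟩ : Fin n) (1 : ℂ)) ∈ L := by
      rw [hL]
      intro j hj
      rw [Pi.single_eq_of_ne]
      rintro rfl
      simp at hj
    rw [h, Submodule.mem_bot] at this
    simp at this
  · have : L < ⊤ := by
      rw [lt_top_iff_ne_top]
      intro h
      have : (Pi.single (⟨2, by omega⟩ : Fin n) (1 : ℂ)) ∈ L := by rw [h]; trivial
      have := (hL _).1 this ⟨2, by omega⟩ le_rfl
      simp at this
    have := Submodule.finrank_lt this.ne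
    simpa using this
  · intro x hx
    obtain ⟨Y, rfl⟩ := exists_ext x
    rw [hL] at hx ⊢
    intro j hj
    rw [wsM_mulVec']
    split_ifs with h
    · have := hx ⟨j + 1, h⟩ (by simp; omega)
      simp only at this
      rw [this, mul_zero]
    · rfl
  · intro x hx
    obtain ⟨Y, rfl⟩ := exists_ext x
    rw [hL] at hx ⊢
    intro j hj
    rw [wsM_star_mulVec, if_pos (by omega)]
    by_cases h : (j : ℕ) = 2
    · rw [h, e2]; simp
    · have := hx ⟨j - 1, by omega⟩ (by simp; omega)
      simp only at this
      rw [this, mul_zero]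

lemma Base.gauWuD {n : ℕ} {e : ℕ → ℝ} (B : Base n e) : gauWu (wsM n (eD n e) (pD e)) = 2 := by
  have G := B.goodD
  have hn := B.hn
  apply IsGreatest.csSup_eq
  constructor
  · have hsum : ∑ l ∈ Finset.range 2, (pD e l : ℂ) * (-1) ^ l = 0 := by
      rw [G.poly (-1)]; simp
    refine G.mem_gauWu (k := 2) ![1, -1] ?_ ?_
    · intro i; fin_cases i <;> simp
    · intro i j hij
      fin_cases i <;> fin_cases j <;> simp at hij ⊢ <;> simpa using hsum
  · rintro k ⟨f, hf, hfr⟩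
    have hzero : ∀ i, ∀ j : Fin n, 2 ≤ (j : ℕ) → f i j = 0 := by
      intro i
      have h1 := hf i i
      rw [if_pos rfl] at h1
      have h2 := (G.frontier_eq _).1 (hfr i)
      obtain ⟨Y, hY⟩ := exists_vecP G.hp (f i)
      rw [hY] at h1 h2 ⊢
      obtain ⟨u, _, hu⟩ := G.boundary h1 h2
      have hY0 : ∀ j, j + 2 < n → Y (j + 2) = 0 := by
        intro j
        induction j with
        | zero =>
          intro hj
          refine (hu 2 hj).2 ?_
          have e1 := inv_pos.2 (B.hpos 1 le_rfl (by omega))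
          have : eD n e (2 + 1) = (e 2)⁻¹ := by
            unfold eD; rw [if_neg (by omega), if_pos (by omega)]
          rw [this]
          simp [eD, pD]
          simpa using e1
        | succ j ih =>
          intro hj
          have h3 : eD n e (j + 2 + 1) ≠ 0 := by
            unfold eD; rw [if_neg (by omega), if_pos (by omega)]
            exact (inv_pos.2 (B.hpos _ (by omega) (by omega))).ne'
          have := (hu (j + 2) (by omega)).1 h3
          rw [show j + 1 + 2 = j + 2 + 1 by ring, this, ih (by omega), mul_zero]
      intro j hj
      obtain ⟨l, hl⟩ : ∃ l, (j : ℕ) = l + 2 := ⟨j - 2, by omega⟩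
      simp only [vecP]
      rw [hl, hY0 l (by omega), mul_zero]
    let M : Matrix (Fin k) (Fin 2) ℂ := Matrix.of fun i a => star (f i ⟨a, by omega⟩)
    have hM : M * Mᴴ = 1 := by
      ext i j
      rw [Matrix.one_apply, ← hf i j, Matrix.mul_apply]
      obtain ⟨Y, hY⟩ := exists_ext (f i)
      obtain ⟨Z, hZ⟩ := exists_ext (f j)
      have hY2 : ∀ l, 2 ≤ l → l < n → Y l = 0 := by
        intro l hl hln
        have := hzero i ⟨l, hln⟩ hl
        rwa [hY] at this
      have h3 : star (f i) ⬝ᵥ f j = ∑ l ∈ Finset.range n, star (Y l) * Z l := by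
        rw [hY, hZ, ← Fin.sum_univ_eq_sum_range (fun l => star (Y l) * Z l) n]
        rfl
      have h4 : ∑ l ∈ Finset.range n, star (Y l) * Z l
          = ∑ l ∈ Finset.range 2, star (Y l) * Z l := by
        symm
        refine Finset.sum_subset (Finset.range_mono (by omega)) fun l hl hl2 => ?_
        rw [hY2 l (by rw [Finset.mem_range] at hl2; omega) (by simpa using hl)]; simp
      rw [h3, h4, ← Fin.sum_univ_eq_sum_range (fun l => star (Y l) * Z l) 2]
      refine Finset.sum_congr rfl fun a _ => ?_
      simp [M, hY, hZ]
    have h5 := Matrix.rank_mul_le_left M Mᴴ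
    rw [hM, Matrix.rank_one, Fintype.card_fin] at h5
    exact h5.trans (by simpa using Matrix.rank_le_width M)

lemma geom_root {m : ℕ} (z : ℂ) (h : ∑ i ∈ Finset.range m, z ^ i = 0) : z ^ m = 1 := by
  have := geom_sum_mul z m
  rw [h, zero_mul] at this
  exact (sub_eq_zero.1 this.symm)

lemma card_bound {m k : ℕ} (hm : 2 ≤ m) (u : Fin k → ℂ) (hu : ∀ i, ‖u i‖ = 1)
    (hinj : Function.Injective u)
    (h : ∀ i j, i ≠ j → u j = - u i ∨ (u j) ^ m = (u i) ^ m) : k ≤ m := by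
  rcases Nat.lt_or_ge k 3 with hk | hk
  · omega
  have h2 : ∀ i j, (u j) ^ m = (u i) ^ m := by
    intro i j
    by_cases hij : i = j
    · rw [hij]
    rcases h i j hij with h1 | h1
    · obtain ⟨c, hci, hcj⟩ : ∃ c, c ≠ i ∧ c ≠ j := by
        have : ∃ c ∈ (Finset.univ : Finset (Fin k)), c ∉ ({i, j} : Finset (Fin k)) := by
          apply Finset.exists_mem_notMem_of_card_lt_card
          have := Finset.card_le_two (a := i) (b := j)
          simp only [Finset.card_univ, Fintype.card_fin]
          omega
        obtain ⟨c, _, hc⟩ := this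
        simp at hc
        exact ⟨c, hc.1, hc.2⟩
      rcases h i c (Ne.symm hci) with h3 | h3
      · exact absurd (hinj (h3.trans h1.symm)) hcj
      · rcases h j c (Ne.symm hcj) with h4 | h4
        · rw [h1, neg_neg] at h4
          exact absurd (hinj h4) hci
        · rw [← h4, h3]
    · exact h1
  have i0 : Fin k := ⟨0, by omega⟩
  have hmem : ∀ i, u i ∈ (Polynomial.nthRoots m (u i0 ^ m)).toFinset := by
    intro i
    rw [Multiset.mem_toFinset, Polynomial.mem_nthRoots (by omega)]
    exact h2 i0 i
  have := Finset.card_le_card_of_injOn (s := Finset.univ) u (fun i _ => hmem i) hinj.injOn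
  rw [Finset.card_univ, Fintype.card_fin] at this
  exact this.trans ((Multiset.toFinset_card_le _).trans (Polynomial.card_nthRoots _ _))

/-- Given the factorisation of the polynomial, the Gau-Wu number is `m`. -/
lemma Base.gauWu_eq {n : ℕ} {e : ℕ → ℝ} (B : Base n e) {m s : ℕ} (hm : 2 ≤ m)
    (hfac : ∀ z : ℂ, ∑ i ∈ Finset.range n, (e (i + 1) : ℂ) * z ^ i
      = (2 + z ^ s) * ∑ i ∈ Finset.range m, z ^ i) :
    gauWu (wsM n e (pE e)) = m := by
  have G := B.good
  have hn := B.hn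
  apply IsGreatest.csSup_eq
  constructor
  · have hprim := Complex.isPrimitiveRoot_exp m (by omega)
    set ω := Complex.exp (2 * Real.pi * Complex.I / m) with hω
    have hωn : ‖ω‖ = 1 := hprim.norm'_eq_one (by omega)
    have hω1 : star ω * ω = 1 := by rw [Complex.star_def, Complex.conj_mul', hωn]; simp
    refine G.mem_gauWu (k := m) (fun i => ω ^ (i : ℕ)) (fun i => by simp [hωn]) ?_
    intro i j hij
    rw [G.poly, hfac]
    have hz : (star (ω ^ (i : ℕ)) * ω ^ (j : ℕ)) ^ m = 1 := by
      rw [mul_pow, ← star_pow, ← pow_mul, ← pow_mul, mul_comm (i : ℕ), mul_comm (j : ℕ), pow_mul,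
        pow_mul, hprim.pow_eq_one]
      simp
    have hz1 : star (ω ^ (i : ℕ)) * ω ^ (j : ℕ) ≠ 1 := by
      intro h
      apply hij
      have h6 : ω ^ (i : ℕ) * star (ω ^ (i : ℕ)) = 1 := by
        rw [star_pow, ← mul_pow, mul_comm, hω1, one_pow]
      have h7 : ω ^ (j : ℕ) = ω ^ (i : ℕ) := by
        calc ω ^ (j : ℕ) = (ω ^ (i : ℕ) * star (ω ^ (i : ℕ))) * ω ^ (j : ℕ) := by rw [h6, one_mul]
          _ = ω ^ (i : ℕ) := by rw [mul_assoc, h, mul_one]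
      exact Fin.ext (hprim.pow_inj j.2 i.2 h7).symm
    have hg := geom_sum_mul (star (ω ^ (i : ℕ)) * ω ^ (j : ℕ)) m
    rw [hz, sub_self] at hg
    rw [(mul_eq_zero.1 hg).resolve_right (sub_ne_zero.2 hz1)]
    simp
  · rintro k ⟨f, hf, hfr⟩
    have hform : ∀ i, ∃ u c : ℂ, ‖u‖ = 1 ∧ f i = vecP n (pE e) (fun j => c * u ^ j) := by
      intro i
      have h1 := hf i i
      rw [if_pos rfl] at h1
      have h2 := (G.frontier_eq _).1 (hfr i)
      obtain ⟨Y, hY⟩ := exists_vecP G.hp (f i)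
      rw [hY] at h1 h2 ⊢
      obtain ⟨u, hu1, hu⟩ := G.boundary h1 h2
      refine ⟨u, Y 0, hu1, ?_⟩
      have hYj : ∀ j < n, Y j = Y 0 * u ^ j := by
        intro j
        induction j with
        | zero => simp
        | succ j ih =>
          intro hj
          rw [(hu j (by omega)).1 (B.hpos (j + 1) (by omega) hj).ne', ih (by omega)]
          ring
      ext j
      simp only [vecP]
      rw [hYj j j.2]
    choose u c hu hfu using hform
    have hinner : ∀ i j, star (f i) ⬝ᵥ f j = star (c i) * c j *
        ((1 + star (u i) * u j) * ((2 + (star (u i) * u j) ^ s) *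
          ∑ l ∈ Finset.range m, (star (u i) * u j) ^ l)) := by
      intro i j
      rw [← hfac, ← G.poly, hfu i, hfu j, inner_vecP G.hp, Finset.mul_sum]
      refine Finset.sum_congr rfl fun l _ => ?_
      rw [star_mul', star_pow, mul_pow]; ring
    have hc : ∀ i, c i ≠ 0 := by
      intro i h
      have h1 := hinner i i
      rw [hf i i, if_pos rfl, h] at h1
      simp at h1
    have huu : ∀ i, u i * star (u i) = 1 := by
      intro i
      rw [Complex.star_def, Complex.mul_conj', hu i]; simp
    have hroot : ∀ i j, i ≠ j → star (u i) * u j = -1 ∨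
        ∑ l ∈ Finset.range m, (star (u i) * u j) ^ l = 0 := by
      intro i j hij
      have h1 := hinner i j
      rw [hf i j, if_neg hij] at h1
      have h2 := (mul_eq_zero.1 h1.symm).resolve_left
        (mul_ne_zero (star_ne_zero.2 (hc i)) (hc j))
      rcases mul_eq_zero.1 h2 with h3 | h3
      · left; linear_combination h3
      · right
        refine (mul_eq_zero.1 h3).resolve_left ?_
        intro h4
        have h5 : (star (u i) * u j) ^ s = -2 := by linear_combination h4
        have h6 := congrArg norm h5
        rw [norm_pow, norm_mul, norm_star, hu i, hu j] at h6
        norm_num at h6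
    have hmul : ∀ i j, u j = u i * (star (u i) * u j) := by
      intro i j; rw [← mul_assoc, huu, one_mul]
    refine card_bound hm u hu ?_ ?_
    · intro i j hij
      by_contra hne
      have h1 : star (u i) * u j = 1 := by rw [← hij, mul_comm, huu]
      rcases hroot i j hne with h2 | h2
      · rw [h1] at h2; norm_num at h2
      · rw [h1] at h2
        simp at h2
        omega
    · intro i j hij
      rcases hroot i j hij with h2 | h2
      · left; rw [hmul i j, h2]; ring
      · right
        rw [hmul i j, mul_pow, geom_root _ h2, mul_one]

/-- The concrete choice of `e`. -/
def eC (n m s : ℕ) (i : ℕ) : ℝ :=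
  (if 1 ≤ i ∧ i ≤ m then 2 else 0) + (if s + 1 ≤ i ∧ i < n then 1 else 0)

lemma eC_base {n m s : ℕ} (hn : 5 ≤ n) (hs : s + m + 1 = n) (hsm : s ≤ m) :
    Base n (eC n m s) where
  hn := hn
  he0 := by simp [eC]
  hpos := by
    intro i h1 h2
    unfold eC
    by_cases h : i ≤ m
    · rw [if_pos ⟨h1, h⟩]; split_ifs <;> norm_num
    · rw [if_neg (by omega), if_pos (by omega)]; norm_num
  hzero := by
    intro i hi
    unfold eC
    rw [if_neg (by omega), if_neg (by omega), add_zero]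

lemma eC_fac {n m s : ℕ} (hs : s + m + 1 = n) (z : ℂ) :
    ∑ i ∈ Finset.range n, (eC n m s (i + 1) : ℂ) * z ^ i
      = (2 + z ^ s) * ∑ i ∈ Finset.range m, z ^ i := by
  have h1 : ∀ i ∈ Finset.range n, (eC n m s (i + 1) : ℂ) * z ^ i
      = (if i < m then 2 * z ^ i else 0) + (if s ≤ i ∧ i < s + m then z ^ i else 0) := by
    intro i _
    unfold eC
    by_cases h2 : i < m
    · rw [if_pos (by omega), if_pos h2]
      by_cases h3 : s ≤ i ∧ i < s + m
      · rw [if_pos (by omega), if_pos h3]; push_cast; ring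
      · rw [if_neg (by omega), if_neg h3]; push_cast; ring
    · rw [if_neg (by omega), if_neg h2]
      by_cases h3 : s ≤ i ∧ i < s + m
      · rw [if_pos (by omega), if_pos h3]; push_cast; ring
      · rw [if_neg (by omega), if_neg h3]; push_cast; ring
  rw [Finset.sum_congr rfl h1, Finset.sum_add_distrib, add_mul, ← Finset.sum_filter,
    ← Finset.sum_filter, Finset.mul_sum, Finset.mul_sum]
  congr 1
  · refine Finset.sum_congr ?_ fun _ _ => rfl
    ext i; simp; omega
  · have : (Finset.range n).filter (fun i => s ≤ i ∧ i < s + m) = Finset.Ico s (s + m) := by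
      ext i; simp; omega
    rw [this, Finset.sum_Ico_eq_sum_range, Nat.add_sub_cancel_left]
    exact Finset.sum_congr rfl fun i _ => by rw [pow_add]

/-- For every `n ≥ 5` there exist a unitarily irreducible `A` and a unitarily reducible `A'`
in `M_n(ℂ)` with the same base polynomial and the same numerical range but different Gau–Wu
numbers; indeed with `k(A) = ⌈n/2⌉ = (n+1)/2` and `k(A') = 2`. -/
theorem exists_same_basePoly_different_gauWu {n : ℕ} (hn : 5 ≤ n) :
    ∃ A A' : Matrix (Fin n) (Fin n) ℂ,
      UnitarilyIrreducible A ∧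
      ¬ UnitarilyIrreducible A' ∧
      (∀ x y t : ℝ, basePoly A x y t = basePoly A' x y t) ∧
      numRange A = numRange A' ∧
      gauWu A ≠ gauWu A' ∧
      gauWu A = (n + 1) / 2 ∧
      gauWu A' = 2 := by
  have hB : Base n (eC n ((n + 1) / 2) (n - 1 - (n + 1) / 2)) :=
    eC_base hn (by omega) (by omega)
  have h1 := hB.gauWu_eq (m := (n + 1) / 2) (s := n - 1 - (n + 1) / 2) (by omega)
    (eC_fac (by omega))
  have h2 := hB.gauWuD
  refine ⟨_, _, hB.irred, hB.red, hB.basePoly_eq, ?_, ?_, h1, h2⟩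
  · rw [hB.good.numRange_eq, hB.goodD.numRange_eq]
  · rw [h1, h2]; omega
end
end
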